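/- arXiv:1512.09232 — 6 statements merged into one kernel-verified Lean document; each statement's English description precedes it below -/
import Mathlib

section
/- The graph Γ̃ obtained by Godsil–McKay switching applied to the Grassmann graph J_q(2e+1,e+1) with respect to the partition {C_U ∪ C_{σ(U)} : U ∈ Gr_e(H)} ∪ {D} is isomorphic to the twisted Grassmann graph J̃_q(2e+1,e). Explicitly: the graph Γ̃ with vertex set Gr_{e+1}(V), in which two distinct vertices W_1, W_2 are adjacent iff either (i) W_1, W_2 ∈ A and dim(W_1 ∩ W_2) = e, or (ii) W_1, W_2 ∈ D and dim(W_1 ∩ W_2) = e, or (iii) {W_1, W_2} = {W, W'} with W ∈ C_U for some U ∈ Gr_e(H), W' ∈ D, and σ(U) ⊆ W', is isomorphic to the twisted Grassmann graph. -/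
/-- The graph `Γ̃` obtained by Godsil–McKay switching from the Grassmann graph
`J_q(2e+1,e+1)` with respect to the partition `{C_U ∪ C_{σ(U)} : U ∈ Gr_e(H)} ∪ {D}`:
its vertices are the `(e+1)`-dimensional subspaces of `V`, and two distinct vertices
`W₁, W₂` are adjacent iff either
(i) `W₁, W₂ ∈ A` (i.e. neither is contained in `H`) and `dim (W₁ ∩ W₂) = e`, or
(ii) `W₁, W₂ ∈ D = Gr_{e+1}(H)` and `dim (W₁ ∩ W₂) = e`, or
(iii) one of them lies in `C_U` for some `U ∈ Gr_e(H)`, the other lies in `D`, and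
`σ(U) ⊆` the latter. -/
def switchedGraph {F V : Type*} [Field F] [AddCommGroup V] [Module F V]
    (e : ℕ) (H : Submodule F V) (σ : Submodule F ↥H → Submodule F ↥H) :
    SimpleGraph {W : Submodule F V // Module.finrank F ↥W = e + 1} :=
  SimpleGraph.fromRel fun W₁ W₂ =>
    (¬ W₁.1 ≤ H ∧ ¬ W₂.1 ≤ H ∧ Module.finrank F ↥(W₁.1 ⊓ W₂.1) = e) ∨
    (W₁.1 ≤ H ∧ W₂.1 ≤ H ∧ Module.finrank F ↥(W₁.1 ⊓ W₂.1) = e) ∨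
    (∃ U : Submodule F ↥H, Module.finrank F ↥U = e ∧
      ¬ W₁.1 ≤ H ∧ Submodule.comap H.subtype W₁.1 = U ∧
      W₂.1 ≤ H ∧ Submodule.map H.subtype (σ U) ≤ W₂.1)

/-- The adjacency relation of the twisted Grassmann graph `J̃_q(2e+1,e)`: vertices are
`A ⊕ Gr_{e-1}(H)`, where `A = {W ∈ Gr_{e+1}(V) : W ⊄ H}`, with `W₁ ∼ W₂` iff
`dim (W₁ ∩ W₂) = e` for `W₁, W₂ ∈ A`; `W₂ ⊆ W₁` for `W₁ ∈ A`, `W₂ ∈ Gr_{e-1}(H)`;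
and `dim (W₁ ∩ W₂) = e - 2` for `W₁, W₂ ∈ Gr_{e-1}(H)`. -/
def twistedAdj {F V : Type*} [Field F] [AddCommGroup V] [Module F V]
    (e : ℕ) (H : Submodule F V) :
    ({W : Submodule F V // Module.finrank F ↥W = e + 1 ∧ ¬ W ≤ H} ⊕
      {U : Submodule F ↥H // Module.finrank F ↥U = e - 1}) →
    ({W : Submodule F V // Module.finrank F ↥W = e + 1 ∧ ¬ W ≤ H} ⊕
      {U : Submodule F ↥H // Module.finrank F ↥U = e - 1}) → Prop
  | Sum.inl W₁, Sum.inl W₂ => Module.finrank F ↥(W₁.1 ⊓ W₂.1) = e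
  | Sum.inl W₁, Sum.inr U₂ => Submodule.map H.subtype U₂.1 ≤ W₁.1
  | Sum.inr _, Sum.inl _ => False
  | Sum.inr U₁, Sum.inr U₂ => Module.finrank F ↥(U₁.1 ⊓ U₂.1) = e - 2

/-- The twisted Grassmann graph `J̃_q(2e+1,e)`. -/
def twistedGrassmannGraph {F V : Type*} [Field F] [AddCommGroup V] [Module F V]
    (e : ℕ) (H : Submodule F V) :
    SimpleGraph ({W : Submodule F V // Module.finrank F ↥W = e + 1 ∧ ¬ W ≤ H} ⊕
      {U : Submodule F ↥H // Module.finrank F ↥U = e - 1}) :=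
  SimpleGraph.fromRel (twistedAdj e H)

theorem polarity_finrank {F M : Type*} [Field F] [AddCommGroup M] [Module F M]
    [FiniteDimensional F M] (σ : Submodule F M → Submodule F M)
    (hσinv : ∀ U, σ (σ U) = U)
    (hσanti : ∀ U U' : Submodule F M, U ≤ U' → σ U' ≤ σ U) (U : Submodule F M) :
    Module.finrank F ↥(σ U) + Module.finrank F ↥U = Module.finrank F M := by
  have hstrict : ∀ A B : Submodule F M, A < B → σ B < σ A := by
    intro A B h
    refine lt_of_le_of_ne (hσanti _ _ h.le) fun h' => h.ne ?_
    rw [← hσinv A, ← hσinv B, h']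
  have lower : ∀ n : ℕ, ∀ A : Submodule F M, Module.finrank F M - Module.finrank F ↥A = n →
      Module.finrank F M ≤ Module.finrank F ↥(σ A) + Module.finrank F ↥A := by
    intro n
    induction n with
    | zero =>
      intro A hA
      omega
    | succ n ih =>
      intro A hA
      have hne : A ≠ ⊤ := by
        rintro rfl
        rw [finrank_top] at hA
        omega
      obtain ⟨v, hv⟩ : ∃ v, v ∉ A := by
        by_contra! h
        exact hne (eq_top_iff.2 fun x _ => h x)
      have hlt : A < A ⊔ Submodule.span F {v} := by
        refine lt_of_le_of_ne le_sup_left fun h => hv ?_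
        rw [h]
        exact Submodule.mem_sup_right (Submodule.mem_span_singleton_self v)
      have h1 := Submodule.finrank_lt_finrank_of_lt hlt
      have h2 := Submodule.finrank_lt_finrank_of_lt (hstrict _ _ hlt)
      have h3 := Submodule.finrank_add_le_finrank_add_finrank A (Submodule.span F {v})
      have h4 : Module.finrank F ↥(Submodule.span F {v}) ≤ 1 := by
        simpa using finrank_span_le_card (R := F) ({v} : Set M)
      have h5 := ih (A ⊔ Submodule.span F {v}) (by omega)
      omega
  have upper : ∀ n : ℕ, ∀ A : Submodule F M, Module.finrank F ↥A = n →
      Module.finrank F ↥(σ A) + Module.finrank F ↥A ≤ Module.finrank F M := by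
    intro n
    induction n with
    | zero =>
      intro A hA
      have := Submodule.finrank_le (σ A)
      omega
    | succ n ih =>
      intro A hA
      have hne : A ≠ ⊥ := by
        rintro rfl
        simp at hA
      obtain ⟨v, hv, hv0⟩ := Submodule.exists_mem_ne_zero_of_ne_bot hne
      obtain ⟨K, hK⟩ := exists_isCompl (Submodule.span F {v})
      have h1 := Submodule.finrank_add_eq_of_isCompl hK
      rw [finrank_span_singleton hv0] at h1
      have hvA : Submodule.span F {v} ≤ A := by
        rwa [Submodule.span_singleton_le_iff_mem]
      have h2 : A ⊔ K = ⊤ := by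
        rw [eq_top_iff, ← hK.sup_eq_top]
        exact sup_le_sup_right hvA K
      have h3 := Submodule.finrank_sup_add_finrank_inf_eq A K
      rw [h2, finrank_top] at h3
      have hlt : A ⊓ K < A := by
        refine lt_of_le_of_ne inf_le_left fun h => ?_
        rw [h] at h3
        omega
      have h4 := Submodule.finrank_lt_finrank_of_lt (hstrict _ _ hlt)
      have h5 := ih (A ⊓ K) (by omega)
      omega
  exact le_antisymm (upper _ U rfl) (lower _ U rfl)

theorem polarity_inf {F M : Type*} [Field F] [AddCommGroup M] [Module F M]
    (σ : Submodule F M → Submodule F M)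
    (hσinv : ∀ U, σ (σ U) = U)
    (hσanti : ∀ U U' : Submodule F M, U ≤ U' → σ U' ≤ σ U) (A B : Submodule F M) :
    σ A ⊓ σ B = σ (A ⊔ B) := by
  apply le_antisymm
  · rw [← hσinv (σ A ⊓ σ B)]
    apply hσanti
    apply sup_le
    · have := hσanti _ _ (inf_le_left : σ A ⊓ σ B ≤ σ A)
      rwa [hσinv] at this
    · have := hσanti _ _ (inf_le_right : σ A ⊓ σ B ≤ σ B)
      rwa [hσinv] at this
  · exact le_inf (hσanti _ _ le_sup_left) (hσanti _ _ le_sup_right)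

/-- The graph `Γ̃` obtained by Godsil–McKay switching applied to the
Grassmann graph `J_q(2e+1,e+1)` with respect to the partition
`{C_U ∪ C_{σ(U)} : U ∈ Gr_e(H)} ∪ {D}` is isomorphic to the twisted Grassmann graph
`J̃_q(2e+1,e)`, where `σ` is a polarity of the hyperplane `H`. -/
theorem stmt_0 {F : Type*} [Field F] [Fintype F]
    {V : Type*} [AddCommGroup V] [Module F V] [FiniteDimensional F V]
    (e : ℕ) (he : 1 ≤ e) (hV : Module.finrank F V = 2 * e + 1)
    (H : Submodule F V) (hH : Module.finrank F ↥H = 2 * e)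
    (σ : Submodule F ↥H → Submodule F ↥H)
    (hσinv : ∀ U, σ (σ U) = U)
    (hσanti : ∀ U U' : Submodule F ↥H, U ≤ U' → σ U' ≤ σ U) :
    Nonempty (switchedGraph e H σ ≃g twistedGrassmannGraph e H) := by
  have hdim := polarity_finrank σ hσinv hσanti
  rw [hH] at hdim
  have hmapdim : ∀ U : Submodule F ↥H,
      Module.finrank F ↥(Submodule.map H.subtype U) = Module.finrank F ↥U := fun U =>
    Submodule.finrank_map_subtype_eq H U
  have hmaple : ∀ U : Submodule F ↥H, Submodule.map H.subtype U ≤ H := fun U =>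
    Submodule.map_subtype_le H U
  have hinj : Function.Injective H.subtype := Submodule.injective_subtype H
  have hcm : ∀ U : Submodule F ↥H, Submodule.comap H.subtype (Submodule.map H.subtype U) = U :=
    fun U => Submodule.comap_map_eq_of_injective hinj U
  have hmc : ∀ W : Submodule F V, Submodule.map H.subtype (Submodule.comap H.subtype W) = H ⊓ W :=
    fun W => Submodule.map_comap_subtype H W
  have hσsymm : ∀ A B : Submodule F ↥H, σ A ≤ B → σ B ≤ A := by
    intro A B h
    have := hσanti _ _ h
    rwa [hσinv] at this
  -- the intersection of an element of `A` with `H` has dimension `e`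
  have hcut : ∀ W : Submodule F V, Module.finrank F ↥W = e + 1 → ¬ W ≤ H →
      Module.finrank F ↥(Submodule.comap H.subtype W) = e := by
    intro W hW hWH
    rw [← hmapdim, hmc]
    have h1 := Submodule.finrank_sup_add_finrank_inf_eq H W
    have h2 : H < H ⊔ W := lt_of_le_of_ne le_sup_left fun h => hWH (h ▸ le_sup_right)
    have h3 := Submodule.finrank_lt_finrank_of_lt h2
    have h4 := Submodule.finrank_le (H ⊔ W)
    omega
  let g : ({W : Submodule F V // Module.finrank F ↥W = e + 1 ∧ ¬ W ≤ H} ⊕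
      {U : Submodule F ↥H // Module.finrank F ↥U = e - 1}) →
      {W : Submodule F V // Module.finrank F ↥W = e + 1} :=
    Sum.elim (fun W => ⟨W.1, W.2.1⟩) (fun U => ⟨Submodule.map H.subtype (σ U.1), by
      have h1 := hdim U.1
      have h2 := U.2
      rw [hmapdim]
      omega⟩)
  have gl : ∀ W, (g (Sum.inl W)).1 = W.1 := fun _ => rfl
  have gr : ∀ U, (g (Sum.inr U)).1 = Submodule.map H.subtype (σ U.1) := fun _ => rfl
  have ginj : Function.Injective g := by
    rintro (W | U) (W' | U') h
    · have h' := congrArg Subtype.val h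
      rw [gl, gl] at h'
      rw [Subtype.ext h']
    · have h' := congrArg Subtype.val h
      rw [gl, gr] at h'
      exact absurd (h' ▸ hmaple _) W.2.2
    · have h' := congrArg Subtype.val h
      rw [gl, gr] at h'
      exact absurd (h' ▸ hmaple _) W'.2.2
    · have h' := congrArg Subtype.val h
      rw [gr, gr] at h'
      have h2 := Submodule.map_injective_of_injective hinj h'
      have h3 : U.1 = U'.1 := by rw [← hσinv U.1, h2, hσinv]
      rw [Subtype.ext h3]
  have gsurj : Function.Surjective g := by
    rintro ⟨W, hW⟩
    by_cases hWH : W ≤ H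
    · have hm : Submodule.map H.subtype (Submodule.comap H.subtype W) = W := by
        rw [hmc, inf_eq_right.2 hWH]
      refine ⟨Sum.inr ⟨σ (Submodule.comap H.subtype W), ?_⟩, ?_⟩
      · have h1 := hdim (Submodule.comap H.subtype W)
        have h2 := hmapdim (Submodule.comap H.subtype W)
        rw [hm] at h2
        omega
      · apply Subtype.ext
        rw [gr]
        simp only [hσinv, hm]
    · exact ⟨Sum.inl ⟨W, hW, hWH⟩, rfl⟩
  have mixed : ∀ (W : {W : Submodule F V // Module.finrank F ↥W = e + 1 ∧ ¬ W ≤ H})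
      (U : {U : Submodule F ↥H // Module.finrank F ↥U = e - 1}),
      Submodule.map H.subtype (σ (Submodule.comap H.subtype W.1)) ≤
        Submodule.map H.subtype (σ U.1) ↔ Submodule.map H.subtype U.1 ≤ W.1 := by
    intro W U
    rw [Submodule.map_le_map_iff_of_injective hinj, Submodule.map_le_iff_le_comap]
    constructor
    · intro h
      have := hσanti _ _ h
      rwa [hσinv, hσinv] at this
    · exact hσanti _ _
  have key : ∀ U U' : {U : Submodule F ↥H // Module.finrank F ↥U = e - 1}, U ≠ U' →
      (Module.finrank F
        ↥(Submodule.map H.subtype (σ U.1) ⊓ Submodule.map H.subtype (σ U'.1)) = e ↔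
        Module.finrank F ↥(U.1 ⊓ U'.1) = e - 2) := by
    intro U U' hne
    rw [← Submodule.map_inf _ hinj, hmapdim, polarity_inf σ hσinv hσanti]
    have h1 := hdim (U.1 ⊔ U'.1)
    have h2 := Submodule.finrank_sup_add_finrank_inf_eq U.1 U'.1
    have h3 := U.2
    have h4 := U'.2
    have h5 : Module.finrank F ↥(U.1 ⊓ U'.1) < e - 1 := by
      have hle := Submodule.finrank_mono (inf_le_left : U.1 ⊓ U'.1 ≤ U.1)
      refine lt_of_le_of_ne (by omega) fun h => hne (Subtype.ext ?_)
      have a := Submodule.eq_of_le_of_finrank_eq (inf_le_left : U.1 ⊓ U'.1 ≤ U.1) (by omega)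
      have b := Submodule.eq_of_le_of_finrank_eq (inf_le_right : U.1 ⊓ U'.1 ≤ U'.1) (by omega)
      rw [← a, b]
    omega
  refine ⟨RelIso.symm ⟨Equiv.ofBijective g ⟨ginj, gsurj⟩, ?_⟩⟩
  intro a b
  change (switchedGraph e H σ).Adj (g a) (g b) ↔ (twistedGrassmannGraph e H).Adj a b
  simp only [switchedGraph, twistedGrassmannGraph,
    SimpleGraph.fromRel_adj, ginj.ne_iff]
  refine and_congr_right fun hab => ?_
  rcases a with W | U <;> rcases b with W' | U'
  · have := W.2.2
    have := W'.2.2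
    simp only [gl, twistedAdj]
    tauto
  · have h1 := W.2.2
    have h2 := hmaple (σ U'.1)
    have h3 := hcut W.1 W.2.1 h1
    have h4 := mixed W U'
    simp only [gl, gr, twistedAdj, h1, h2, ← h4]
    simp [h3]
  · have h1 := W'.2.2
    have h2 := hmaple (σ U.1)
    have h3 := hcut W'.1 W'.2.1 h1
    have h4 := mixed W' U
    simp only [gl, gr, twistedAdj, h1, h2, ← h4]
    simp [h3]
  · have h1 := hmaple (σ U.1)
    have h2 := hmaple (σ U'.1)
    have h3 := key U U' (fun h => hab (by rw [h]))
    have h4 := key U' U (fun h => hab (by rw [h]))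
    simp only [gr, twistedAdj, h1, h2]
    simp
    exact or_congr h3 h4
end

section
/- Let {C_1, …, C_t} be an equitable partition of the Grassmann graph J_q(2e,e) with vertex set Gr_e(H), with constants m_{ij} (every vertex of C_j has exactly m_{ij} neighbors in C_i). For 1 ≤ i ≤ t, set C̃_i = {W ∈ Gr_{e+1}(V) : W ∩ H ∈ C_i}. Then {C̃_1, …, C̃_t} is an equitable partition of the subgraph of J_q(2e+1,e+1) induced on A; moreover, every vertex in C̃_j has exactly q·m_{ij} + δ_{ij}(q^e − 1) neighbors in C̃_i. -/
section aux
variable {F : Type*} [Field F] {V : Type*} [AddCommGroup V] [Module F V]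

theorem aux_finrank_le (H W : Submodule F V) (h : W ≤ H) :
    Module.finrank F ↥(Submodule.comap H.subtype W) = Module.finrank F ↥W :=
  (Submodule.comapSubtypeEquivOfLe h).finrank_eq

theorem aux_decomp [FiniteDimensional F V] (H : Submodule F V)
    (hd : Module.finrank F V = Module.finrank F ↥H + 1) (w : V) (hw : w ∉ H) (v : V) :
    ∃ h ∈ H, ∃ c : F, h + c • w = v := by
  have h1 : H ⊔ Submodule.span F {w} = ⊤ := by
    apply Submodule.eq_top_of_finrank_eq
    have hlt : H < H ⊔ Submodule.span F {w} := by
      refine lt_of_le_of_ne le_sup_left fun h => hw ?_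
      rw [h]
      exact Submodule.mem_sup_right (Submodule.mem_span_singleton_self w)
    have := Submodule.finrank_lt_finrank_of_lt hlt
    have h3 := Submodule.finrank_le (H ⊔ Submodule.span F {w})
    omega
  have h2 : v ∈ H ⊔ Submodule.span F {w} := by rw [h1]; trivial
  obtain ⟨h, hh, y, hy, rfl⟩ := Submodule.mem_sup.1 h2
  obtain ⟨c, rfl⟩ := Submodule.mem_span_singleton.1 hy
  exact ⟨h, hh, c, rfl⟩

theorem aux_finrank_not_le [FiniteDimensional F V] (H W : Submodule F V)
    (hd : Module.finrank F V = Module.finrank F ↥H + 1) (hW : ¬ W ≤ H) :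
    Module.finrank F ↥W = Module.finrank F ↥(Submodule.comap H.subtype W) + 1 := by
  have h0 : Submodule.comap H.subtype W = Submodule.comap H.subtype (W ⊓ H) := by
    ext x; simp
  rw [h0, aux_finrank_le H (W ⊓ H) inf_le_right]
  have h1 : W ⊔ H = ⊤ := by
    obtain ⟨w, hw, hwH⟩ := Set.not_subset.1 hW
    rw [eq_top_iff]
    intro v _
    obtain ⟨h, hh, c, rfl⟩ := aux_decomp H hd w hwH v
    exact add_mem (Submodule.mem_sup_right hh) (Submodule.mem_sup_left (W.smul_mem c hw))
  have := Submodule.finrank_sup_add_finrank_inf_eq W H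
  rw [h1, finrank_top] at this
  omega

theorem aux_rep [FiniteDimensional F V] (H W : Submodule F V)
    (hd : Module.finrank F V = Module.finrank F ↥H + 1) (hW : ¬ W ≤ H) (w : V) (hw : w ∉ H) :
    ∃ h : ↥H, w + (h : V) ∈ W := by
  obtain ⟨v, hv, hvH⟩ := Set.not_subset.1 hW
  obtain ⟨h, hh, c, rfl⟩ := aux_decomp H hd w hw v
  have hc : c ≠ 0 := by
    rintro rfl
    apply hvH
    simpa using hh
  refine ⟨⟨c⁻¹ • h, H.smul_mem _ hh⟩, ?_⟩
  have := W.smul_mem c⁻¹ hv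
  rw [smul_add, smul_smul, inv_mul_cancel₀ hc, one_smul, add_comm] at this
  exact this

/-- the subspace `U + ⟨w + h⟩` -/
def auxSp (H : Submodule F V) (U : Submodule F ↥H) (w : V) (h : ↥H) : Submodule F V :=
  U.map H.subtype ⊔ Submodule.span F {w + (h : V)}

theorem mem_auxSp (H : Submodule F V) (U : Submodule F ↥H) (w : V) (h : ↥H) (v : V) :
    v ∈ auxSp H U w h ↔ ∃ u ∈ U, ∃ c : F, (u : V) + c • (w + (h : V)) = v := by
  unfold auxSp
  constructor
  · intro hv
    obtain ⟨x, hx, y, hy, rfl⟩ := Submodule.mem_sup.1 hv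
    obtain ⟨c, rfl⟩ := Submodule.mem_span_singleton.1 hy
    obtain ⟨u, hu, rfl⟩ := Submodule.mem_map.1 hx
    exact ⟨u, hu, c, rfl⟩
  · rintro ⟨u, hu, c, rfl⟩
    exact add_mem (Submodule.mem_sup_left (Submodule.mem_map_of_mem (f := H.subtype) hu))
      (Submodule.mem_sup_right (Submodule.smul_mem _ _ (Submodule.mem_span_singleton_self _)))

theorem aux_coef (H : Submodule F V) (w : V) (hw : w ∉ H) (c : F) (h : c • w ∈ H) : c = 0 := by
  by_contra hc
  exact hw ((H.smul_mem_iff hc).1 h)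

theorem mem_auxSp_H (H : Submodule F V) (U : Submodule F ↥H) (w : V) (hw : w ∉ H) (h x : ↥H) :
    (x : V) ∈ auxSp H U w h ↔ x ∈ U := by
  rw [mem_auxSp]
  constructor
  · rintro ⟨u, hu, c, hc⟩
    have : c = 0 := by
      apply aux_coef H w hw
      have : c • w = ((x - u - c • h : ↥H) : V) := by
        push_cast
        rw [← hc, smul_add]; abel
      rw [this]; exact Subtype.property _
    subst this
    have : x = u := by
      apply Subtype.ext
      simpa using hc.symm
    exact this ▸ hu
  · intro hx
    exact ⟨x, hx, 0, by simp⟩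

theorem mem_auxSp_w (H : Submodule F V) (U : Submodule F ↥H) (w : V) (hw : w ∉ H) (h x : ↥H) :
    w + (x : V) ∈ auxSp H U w h ↔ x - h ∈ U := by
  have hself : w + (h : V) ∈ auxSp H U w h :=
    Submodule.mem_sup_right (Submodule.mem_span_singleton_self _)
  rw [← mem_auxSp_H H U w hw h (x - h), ← Submodule.sub_mem_iff_left _ hself]
  have : w + (x : V) - (w + (h : V)) = ((x - h : ↥H) : V) := by push_cast; abel
  rw [this]

theorem aux_count [Fintype F] [FiniteDimensional F V] (H : Submodule F V)
    (hd : Module.finrank F V = Module.finrank F ↥H + 1) (w : V) (hw : w ∉ H)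
    (U S : Submodule F ↥H) (hUS : U ≤ S) (d : ℕ)
    (hS : Module.finrank F ↥S = Module.finrank F ↥U + d) :
    {W : Submodule F V | Submodule.comap H.subtype W = U ∧ ∃ h ∈ S, w + (h : V) ∈ W}.ncard
      = Fintype.card F ^ d := by
  have himg : {W : Submodule F V | Submodule.comap H.subtype W = U ∧ ∃ h ∈ S, w + (h : V) ∈ W}
      = (fun x : ↥H ⧸ U => auxSp H U w (Quotient.out x)) '' (S.map U.mkQ : Set (↥H ⧸ U)) := by
    ext W
    simp only [Set.mem_ofPred_eq, Set.mem_image, SetLike.mem_coe]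
    constructor
    · rintro ⟨hU, h, hh, hW⟩
      refine ⟨U.mkQ h, Submodule.mem_map_of_mem hh, ?_⟩
      have ho : h - Quotient.out (U.mkQ h) ∈ U := by
        rw [← Submodule.Quotient.eq]
        exact (Quotient.out_eq (U.mkQ h)).symm
      generalize Quotient.out (U.mkQ h) = k at ho
      have hk : w + (k : V) ∈ W := by
        have h1 : ((h - k : ↥H) : V) ∈ W := by
          have : h - k ∈ Submodule.comap H.subtype W := by rw [hU]; exact ho
          exact this
        have := W.sub_mem hW h1
        have e1 : w + (h : V) - ((h - k : ↥H) : V) = w + (k : V) := by push_cast; abel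
        rwa [e1] at this
      apply le_antisymm
      · intro v hv
        obtain ⟨u, hu, c, rfl⟩ := (mem_auxSp H U w k v).1 hv
        refine add_mem ?_ (W.smul_mem c hk)
        rw [← hU] at hu
        exact hu
      · intro v hv
        obtain ⟨a, ha, c, rfl⟩ := aux_decomp H hd w hw v
        rw [mem_auxSp]
        refine ⟨⟨a, ha⟩ - c • k, ?_, c, ?_⟩
        · rw [← hU]
          change ((⟨a, ha⟩ - c • k : ↥H) : V) ∈ W
          have := W.sub_mem hv (W.smul_mem c hk)
          have e1 : a + c • w - c • (w + (k : V)) = ((⟨a, ha⟩ - c • k : ↥H) : V) := by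
            push_cast; rw [smul_add]; abel
          rwa [e1] at this
        · push_cast; rw [smul_add]; abel
    · rintro ⟨x, hx, rfl⟩
      refine ⟨?_, Quotient.out x, ?_, ?_⟩
      · ext y
        exact mem_auxSp_H H U w hw _ y
      · obtain ⟨s, hs, hsx⟩ := Submodule.mem_map.1 hx
        have ho : Quotient.out x - s ∈ U := by
          rw [← Submodule.Quotient.eq]
          exact (Quotient.out_eq x).trans hsx.symm
        have := S.add_mem (hUS ho) hs
        simpa using this
      · rw [mem_auxSp_w H U w hw]; simp
  rw [himg, Set.InjOn.ncard_image]
  · have hfin : Finite (↥H ⧸ U) := Module.finite_of_finite F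
    have hr := LinearMap.finrank_range_add_finrank_ker (U.mkQ.comp S.subtype)
    rw [LinearMap.range_comp, Submodule.range_subtype, LinearMap.ker_comp, Submodule.ker_mkQ,
      aux_finrank_le S U hUS] at hr
    have hc := Module.natCard_eq_pow_finrank (K := F) (V := ↥(S.map U.mkQ))
    rw [Nat.card_eq_fintype_card (α := F)] at hc
    have hd' : Module.finrank F ↥(S.map U.mkQ) = d := by omega
    rw [hd'] at hc
    rw [← hc]
    exact (Nat.card_coe_set_eq _).symm
  · intro x _ y _ hxy
    have hxy' : auxSp H U w (Quotient.out x) = auxSp H U w (Quotient.out y) := hxy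
    have : w + ((Quotient.out x : ↥H) : V) ∈ auxSp H U w (Quotient.out y) := by
      rw [← hxy', mem_auxSp_w H U w hw]; simp
    rw [mem_auxSp_w H U w hw, ← Submodule.Quotient.eq] at this
    exact (Quotient.out_eq x).symm.trans (this.trans (Quotient.out_eq y))

theorem aux_fiber {α β : Type*} [Finite α] [Finite β] (s : Set α) (t : Set β) (f : α → β) (k : ℕ)
    (hst : ∀ a ∈ s, f a ∈ t) (hk : ∀ b ∈ t, {a | a ∈ s ∧ f a = b}.ncard = k) :
    s.ncard = k * t.ncard := by
  classical
  have := Fintype.ofFinite α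
  have := Fintype.ofFinite β
  rw [Set.ncard_eq_toFinset_card' s, Set.ncard_eq_toFinset_card' t,
    Finset.card_eq_sum_card_fiberwise (f := f) (t := t.toFinset), Finset.sum_const_nat (m := k),
    mul_comm]
  · intro b hb
    rw [← hk b (by simpa using hb), Set.ncard_eq_toFinset_card']
    congr 1
    ext a
    simp
  · intro a ha
    simpa using hst a (by simpa using ha)

end aux


/-- The lift `C̃` of a set `C` of `e`-dimensional subspaces of the hyperplane `H`:
`C̃ = {W ∈ Gr_{e+1}(V) : W ⊄ H, W ∩ H ∈ C}` (the condition `W ⊄ H` is automatic when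
`W ∩ H` has dimension `e`, i.e. this is the set of `W ∈ A` with `W ∩ H ∈ C`). -/
def liftCell {F V : Type*} [Field F] [AddCommGroup V] [Module F V]
    (e : ℕ) (H : Submodule F V) (C : Set (Submodule F ↥H)) : Set (Submodule F V) :=
  {W | (Module.finrank F ↥W = e + 1 ∧ ¬ W ≤ H) ∧ Submodule.comap H.subtype W ∈ C}

/-- If `{C_1, …, C_t}` is an equitable partition of the Grassmann graph
`J_q(2e,e)` on `Gr_e(H)` with constants `m_{ij}` (every vertex of `C_j` has exactly
`m_{ij}` neighbors in `C_i`), then `{C̃_1, …, C̃_t}`, where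
`C̃_i = {W ∈ Gr_{e+1}(V) : W ∩ H ∈ C_i}`, is an equitable partition of the subgraph of
`J_q(2e+1,e+1)` induced on `A`, every vertex of `C̃_j` having exactly
`q·m_{ij} + δ_{ij}(q^e − 1)` neighbors in `C̃_i`. -/
theorem stmt_2 {F : Type*} [Field F] [Fintype F]
    {V : Type*} [AddCommGroup V] [Module F V] [FiniteDimensional F V]
    (q e : ℕ) (hq : Fintype.card F = q) (he : 1 ≤ e)
    (hV : Module.finrank F V = 2 * e + 1)
    (H : Submodule F V) (hH : Module.finrank F ↥H = 2 * e)
    (t : ℕ) (C : Fin t → Set (Submodule F ↥H)) (m : Fin t → Fin t → ℕ)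
    (hdisj : Pairwise fun i j => Disjoint (C i) (C j))
    (hcover : (⋃ i, C i) = {U : Submodule F ↥H | Module.finrank F ↥U = e})
    (hm : ∀ i j, ∀ U' ∈ C j,
      {U ∈ C i | Module.finrank F ↥(U ⊓ U') = e - 1}.ncard = m i j) :
    (Pairwise fun i j => Disjoint (liftCell e H (C i)) (liftCell e H (C j))) ∧
    (⋃ i, liftCell e H (C i)) =
      {W : Submodule F V | Module.finrank F ↥W = e + 1 ∧ ¬ W ≤ H} ∧
    ∀ i j, ∀ W' ∈ liftCell e H (C j),
      {W ∈ liftCell e H (C i) | Module.finrank F ↥(W ⊓ W') = e}.ncard =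
        q * m i j + (if i = j then q ^ e - 1 else 0) := by
  have hd : Module.finrank F V = Module.finrank F ↥H + 1 := by omega
  have hCe : ∀ i, ∀ U ∈ C i, Module.finrank F ↥U = e := by
    intro i U hU
    have : U ∈ ⋃ i, C i := Set.mem_iUnion.2 ⟨i, hU⟩
    rw [hcover] at this
    exact this
  have hCinj : ∀ i j U, U ∈ C i → U ∈ C j → i = j := by
    intro i j U hi hj
    by_contra hij
    exact Set.disjoint_left.1 (hdisj hij) hi hj
  have hmem : ∀ i W, W ∈ liftCell e H (C i) ↔
      (Module.finrank F ↥W = e + 1 ∧ ¬ W ≤ H) ∧ Submodule.comap H.subtype W ∈ C i :=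
    fun i W => Iff.rfl
  refine ⟨?_, ?_, ?_⟩
  · intro i j hij
    rw [Set.disjoint_left]
    intro W h1 h2
    exact hij (hCinj i j _ ((hmem _ _).1 h1).2 ((hmem _ _).1 h2).2)
  · ext W
    rw [Set.mem_iUnion]
    constructor
    · rintro ⟨i, hi⟩
      exact ((hmem _ _).1 hi).1
    · intro hW
      have hW' : Module.finrank F ↥W = e + 1 ∧ ¬ W ≤ H := hW
      have h1 := aux_finrank_not_le H W hd hW'.2
      have h2 : Submodule.comap H.subtype W ∈ ⋃ i, C i := by
        rw [hcover]
        change Module.finrank F ↥(Submodule.comap H.subtype W) = e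
        omega
      obtain ⟨i, hi⟩ := Set.mem_iUnion.1 h2
      exact ⟨i, (hmem _ _).2 ⟨hW', hi⟩⟩
  intro i j W' hW'
  obtain ⟨⟨hW'r, hW'H⟩, hU'⟩ := (hmem _ _).1 hW'
  set U' := Submodule.comap H.subtype W' with hU'def
  have hU'e := hCe j U' hU'
  have memU' : ∀ x : ↥H, (x : V) ∈ W' ↔ x ∈ U' := fun x => Iff.rfl
  obtain ⟨w, hwW, hw⟩ := Set.not_subset.1 hW'H
  have hfinV : Finite V := Module.finite_of_finite F
  have hfinS : Finite (Submodule F V) := inferInstance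
  have hfinSH : Finite (Submodule F ↥H) := inferInstance
  -- a subspace containing a vector `w + h` is not in `H`
  have hnot : ∀ (W : Submodule F V) (h : ↥H), w + (h : V) ∈ W → ¬ W ≤ H := by
    intro W h hh hle
    exact hw ((H.add_mem_iff_left h.2).1 (hle hh))
  set N := {W ∈ liftCell e H (C i) | Module.finrank F ↥(W ⊓ W') = e} with hN
  have memN : ∀ W, W ∈ N ↔ ((Module.finrank F ↥W = e + 1 ∧ ¬ W ≤ H) ∧
      Submodule.comap H.subtype W ∈ C i) ∧ Module.finrank F ↥(W ⊓ W') = e := fun W => Iff.rfl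
  set P : Set (Submodule F V) := {W | Submodule.comap H.subtype W = U'} with hP
  have memP : ∀ W, W ∈ P ↔ Submodule.comap H.subtype W = U' := fun W => Iff.rfl
  have hsplit := Set.ncard_inter_add_ncard_diff_eq_ncard N P (Set.toFinite _)
  have h1 : (N ∩ P).ncard = if i = j then q ^ e - 1 else 0 := by
    split_ifs with hij
    · subst hij
      have hcnt := aux_count H hd w hw U' ⊤ le_top e (by rw [finrank_top]; omega)
      rw [hq] at hcnt
      have heq : N ∩ P = {W : Submodule F V | Submodule.comap H.subtype W = U' ∧
          ∃ h ∈ (⊤ : Submodule F ↥H), w + (h : V) ∈ W} \ {W'} := by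
        ext W
        rw [Set.mem_inter_iff, memN, memP, Set.mem_sdiff, Set.mem_ofPred_eq,
          Set.mem_singleton_iff]
        constructor
        · rintro ⟨⟨⟨⟨hr, hWH⟩, _⟩, hi⟩, hWU⟩
          refine ⟨⟨hWU, ?_⟩, ?_⟩
          · obtain ⟨h, hh⟩ := aux_rep H W hd hWH w hw
            exact ⟨h, trivial, hh⟩
          · rintro rfl
            rw [inf_idem] at hi
            omega
        · rintro ⟨⟨hWU, h, _, hh⟩, hne⟩
          have hWH := hnot W h hh
          have hr := aux_finrank_not_le H W hd hWH
          rw [hWU, hU'e] at hr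
          refine ⟨⟨⟨⟨hr, hWH⟩, hWU ▸ hU'⟩, ?_⟩, hWU⟩
          have hc : Submodule.comap H.subtype (W ⊓ W') = U' := by
            rw [Submodule.comap_inf, hWU, ← hU'def, inf_idem]
          by_cases hle : W ⊓ W' ≤ H
          · rw [← aux_finrank_le H _ hle, hc, hU'e]
          · exfalso
            have h3 := aux_finrank_not_le H _ hd hle
            rw [hc, hU'e] at h3
            apply hne
            have e1 := Submodule.eq_of_le_of_finrank_eq (inf_le_left : W ⊓ W' ≤ W) (by omega)
            have e2 := Submodule.eq_of_le_of_finrank_eq (inf_le_right : W ⊓ W' ≤ W') (by omega)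
            exact e1.symm.trans e2
      rw [heq, Set.ncard_sdiff_singleton_of_mem, hcnt]
      exact ⟨rfl, 0, trivial, by simpa using hwW⟩
    · rw [Set.ncard_eq_zero]
      rw [Set.eq_empty_iff_forall_notMem]
      rintro W ⟨hWN, hWP⟩
      apply hij
      apply hCinj i j U' _ hU'
      rw [← (memP W).1 hWP]
      exact ((memN W).1 hWN).1.2
  have h2 : (N \ P).ncard = q * m i j := by
    rw [← hm i j U' hU']
    have memT : ∀ U, U ∈ {U ∈ C i | Module.finrank F ↥(U ⊓ U') = e - 1} ↔
      U ∈ C i ∧ Module.finrank F ↥(U ⊓ U') = e - 1 := fun U => Iff.rfl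
    have key : ∀ W, W ∈ N \ P → Module.finrank F
        ↥(Submodule.comap H.subtype W ⊓ U') = e - 1 ∧
        ∃ h ∈ Submodule.comap H.subtype W ⊔ U', w + (h : V) ∈ W := by
      rintro W ⟨hWN, hWP⟩
      rw [memN] at hWN
      rw [memP] at hWP
      obtain ⟨⟨⟨hr, hWH⟩, hWC⟩, hi⟩ := hWN
      have hUe := hCe i _ hWC
      have hc : Submodule.comap H.subtype (W ⊓ W') = Submodule.comap H.subtype W ⊓ U' := by
        rw [Submodule.comap_inf]
      by_cases hle : W ⊓ W' ≤ H
      · exfalso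
        have h3 := aux_finrank_le H _ hle
        rw [hc] at h3
        apply hWP
        have e1 := Submodule.eq_of_le_of_finrank_eq
          (inf_le_left : Submodule.comap H.subtype W ⊓ U' ≤ _) (by omega)
        have e2 := Submodule.eq_of_le_of_finrank_eq
          (inf_le_right : Submodule.comap H.subtype W ⊓ U' ≤ _) (by omega)
        exact e1.symm.trans e2
      · have h3 := aux_finrank_not_le H _ hd hle
        rw [hc] at h3
        refine ⟨by omega, ?_⟩
        obtain ⟨h, hh⟩ := aux_rep H _ hd hle w hw
        refine ⟨h, Submodule.mem_sup_right ?_, hh.1⟩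
        rw [← memU']
        exact (W'.add_mem_iff_right hwW).1 hh.2
    apply aux_fiber (N \ P) _ (fun W => Submodule.comap H.subtype W) q
    · intro W hW
      rw [memT]
      exact ⟨((memN W).1 hW.1).1.2, (key W hW).1⟩
    · intro U hU
      rw [memT] at hU
      obtain ⟨hUC, hUi⟩ := hU
      have hUe := hCe i U hUC
      have hsi := Submodule.finrank_sup_add_finrank_inf_eq U U'
      have hcnt := aux_count H hd w hw U (U ⊔ U') le_sup_left 1 (by omega)
      rw [hq, pow_one] at hcnt
      rw [← hcnt]
      congr 1
      ext W
      rw [Set.mem_ofPred_eq, Set.mem_ofPred_eq]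
      constructor
      · rintro ⟨hW, rfl⟩
        exact ⟨rfl, (key W hW).2⟩
      · rintro ⟨rfl, h, hh, hhW⟩
        refine ⟨⟨?_, ?_⟩, rfl⟩
        · rw [memN]
          have hWH := hnot W h hhW
          have hr := aux_finrank_not_le H W hd hWH
          refine ⟨⟨⟨by omega, hWH⟩, hUC⟩, ?_⟩
          obtain ⟨a, ha, b, hb, rfl⟩ := Submodule.mem_sup.1 hh
          have hbW : w + (b : V) ∈ W := by
            have := W.sub_mem hhW (show (a : V) ∈ W from ha)
            have e1 : w + ((a + b : ↥H) : V) - (a : V) = w + (b : V) := by push_cast; abel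
            rwa [e1] at this
          have hbW' : w + (b : V) ∈ W' := W'.add_mem hwW hb
          have h3 := aux_finrank_not_le H _ hd (hnot (W ⊓ W') b ⟨hbW, hbW'⟩)
          rw [Submodule.comap_inf, ← hU'def] at h3
          omega
        · rw [memP]
          intro hEq
          rw [hEq, inf_idem] at hUi
          omega
  rw [← hsplit, h1, h2, add_comm]
end

section
/- Let U, U' ∈ Gr_e(H) with dim(U ∩ U') = e−1, and let W' ∈ Gr_{e+1}(V) with W' ∩ H = U'. Then the number of W ∈ Gr_{e+1}(V) with W ∩ H = U and W ∩ W' ⊄ H equals q. -/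
theorem aux_finrank {F V : Type*} [Field F] [AddCommGroup V] [Module F V] [FiniteDimensional F V]
    (P : Submodule F V) (v : V) (hv : v ∉ P) :
    Module.finrank F ↥(P ⊔ Submodule.span F {v}) = Module.finrank F P + 1 := by
  have hv0 : v ≠ 0 := fun h => hv (h ▸ P.zero_mem)
  have h := Submodule.finrank_sup_add_finrank_inf_eq P (Submodule.span F {v})
  have h2 : P ⊓ Submodule.span F {v} = ⊥ := by
    rw [eq_bot_iff]
    rintro x ⟨hx, hx'⟩
    obtain ⟨c, rfl⟩ := Submodule.mem_span_singleton.1 hx'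
    by_cases hc : c = 0
    · simp [hc]
    · exact absurd ((P.smul_mem_iff hc).1 hx) hv
  rw [h2, finrank_bot, finrank_span_singleton hv0] at h
  simpa using h

theorem aux_mem {F V : Type*} [Field F] [AddCommGroup V] [Module F V] [FiniteDimensional F V]
    (P Q : Submodule F V) (hPQ : P ≤ Q) (hr : Module.finrank F Q = Module.finrank F P + 1)
    (v : V) (hv : v ∉ P) (hvQ : v ∈ Q) : P ⊔ Submodule.span F {v} = Q := by
  apply Submodule.eq_of_le_of_finrank_eq
  · exact sup_le hPQ ((Submodule.span_singleton_le_iff_mem _ _).2 hvQ)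
  · rw [aux_finrank P v hv, hr]

theorem aux_ex {F V : Type*} [Field F] [AddCommGroup V] [Module F V]
    (P : Submodule F V) (v w : V) (hw : w ∈ P ⊔ Submodule.span F {v}) :
    ∃ p ∈ P, ∃ c : F, w = p + c • v := by
  obtain ⟨p, hp, y, hy, rfl⟩ := Submodule.mem_sup.1 hw
  obtain ⟨c, rfl⟩ := Submodule.mem_span_singleton.1 hy
  exact ⟨p, hp, c, rfl⟩


/-- Let `U, U' ∈ Gr_e(H)` with `dim (U ∩ U') = e - 1`, and let
`W' ∈ Gr_{e+1}(V)` with `W' ∩ H = U'`. Then the number of `W ∈ Gr_{e+1}(V)` with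
`W ∩ H = U` and `W ∩ W' ⊄ H` equals `q`. -/
theorem stmt_7 {F : Type*} [Field F] [Fintype F]
    {V : Type*} [AddCommGroup V] [Module F V] [FiniteDimensional F V]
    (q e : ℕ) (hq : Fintype.card F = q) (he : 1 ≤ e)
    (hV : Module.finrank F V = 2 * e + 1)
    (H : Submodule F V) (hH : Module.finrank F ↥H = 2 * e)
    (U U' : Submodule F ↥H)
    (hU : Module.finrank F ↥U = e) (hU' : Module.finrank F ↥U' = e)
    (hUU' : Module.finrank F ↥(U ⊓ U') = e - 1)
    (W' : Submodule F V) (hW' : Module.finrank F ↥W' = e + 1)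
    (hW'H : Submodule.comap H.subtype W' = U') :
    {W : Submodule F V | Module.finrank F ↥W = e + 1 ∧
      Submodule.comap H.subtype W = U ∧ ¬ W ⊓ W' ≤ H}.ncard = q := by
  subst hW'H
  obtain ⟨A, hA⟩ : ∃ A, A = U.map H.subtype := ⟨_, rfl⟩
  have hAH : A ≤ H := hA ▸ Submodule.map_subtype_le H U
  have hAr : Module.finrank F A = e := by
    rw [hA, ← hU]; exact Submodule.finrank_map_subtype_eq H U
  have hcomap : ∀ W : Submodule F V, Submodule.comap H.subtype W = U ↔ H ⊓ W = A := by
    intro W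
    rw [hA, ← Submodule.map_comap_subtype]
    exact (Submodule.map_injective_of_injective H.subtype_injective).eq_iff.symm
  have hA'r : Module.finrank F ↥(H ⊓ W') = e := by
    rw [← Submodule.map_comap_subtype, ← hU']; exact Submodule.finrank_map_subtype_eq H _
  have hBr : Module.finrank F ↥(A ⊓ (H ⊓ W')) = e - 1 := by
    rw [← Submodule.map_comap_subtype H W', hA, ← Submodule.map_inf _ H.subtype_injective, ← hUU']
    exact Submodule.finrank_map_subtype_eq H _
  obtain ⟨w0, hw0, hw0H⟩ : ∃ w ∈ W', w ∉ H := by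
    by_contra! hcon
    have : H ⊓ W' = W' := inf_eq_right.2 hcon
    rw [this] at hA'r
    omega
  obtain ⟨d, hd, hdA⟩ : ∃ d ∈ H ⊓ W', d ∉ A := by
    by_contra! hcon
    have : A ⊓ (H ⊓ W') = H ⊓ W' := inf_eq_right.2 hcon
    rw [this] at hBr
    omega
  have hW'eq := aux_mem (H ⊓ W') W' inf_le_right (by omega) w0 (fun h => hw0H h.1) hw0
  have hBeq := aux_mem (A ⊓ (H ⊓ W')) (H ⊓ W') inf_le_right (by omega) d (fun h => hdA h.1) hd
  have hvH : ∀ t : F, w0 + t • d ∉ H := fun t h =>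
    hw0H ((H.add_mem_iff_left (H.smul_mem t hd.1)).1 h)
  have hset : {W : Submodule F V | Module.finrank F ↥W = e + 1 ∧
      Submodule.comap H.subtype W = U ∧ ¬ W ⊓ W' ≤ H} =
      Set.range (fun t : F => A ⊔ Submodule.span F {w0 + t • d}) := by
    ext W
    simp only [Set.mem_ofPred_eq, Set.mem_range, hcomap]
    constructor
    · rintro ⟨hr, hWA, hn⟩
      obtain ⟨w, ⟨hwW, hwW'⟩, hwH⟩ := SetLike.not_le_iff_exists.1 hn
      rw [← hW'eq] at hwW'
      obtain ⟨a, ha, c, rfl⟩ := aux_ex _ _ _ hwW'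
      have hc : c ≠ 0 := by
        rintro rfl
        apply hwH
        simpa using ha.1
      rw [← hBeq] at ha
      obtain ⟨b, hb, s, rfl⟩ := aux_ex _ _ _ ha
      have hAW : A ≤ W := hWA ▸ inf_le_right
      refine ⟨c⁻¹ * s, aux_mem A W hAW (by omega) _ (fun h => hvH _ (hAH h)) ?_⟩
      have h1 : c⁻¹ • ((b + s • d + c • w0) - b) ∈ W :=
        W.smul_mem _ (W.sub_mem hwW (hAW hb.1))
      convert h1 using 1
      rw [show b + s • d + c • w0 - b = s • d + c • w0 by abel, smul_add, smul_smul, smul_smul,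
        inv_mul_cancel₀ hc, one_smul, add_comm]
    · rintro ⟨t, rfl⟩
      refine ⟨?_, ?_, ?_⟩
      · rw [aux_finrank _ _ (fun h => hvH _ (hAH h)), hAr]
      · apply le_antisymm
        · rintro x ⟨hxH, hx⟩
          obtain ⟨a, ha, c, rfl⟩ := aux_ex _ _ _ hx
          have h2 := (H.add_mem_iff_right (hAH ha)).1 hxH
          by_cases hc : c = 0
          · simpa [hc] using ha
          · exact absurd ((H.smul_mem_iff hc).1 h2) (hvH t)
        · exact le_inf hAH le_sup_left
      · intro h
        exact hvH t (h ⟨Submodule.mem_sup_right (Submodule.mem_span_singleton_self _),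
          W'.add_mem hw0 (W'.smul_mem t hd.2)⟩)
  have hinj : Function.Injective (fun t : F => A ⊔ Submodule.span F {w0 + t • d}) := by
    intro t s hts
    have h1 : w0 + t • d ∈ A ⊔ Submodule.span F {w0 + s • d} := by
      have hts' : A ⊔ Submodule.span F {w0 + t • d} = A ⊔ Submodule.span F {w0 + s • d} := hts
      rw [← hts']
      exact Submodule.mem_sup_right (Submodule.mem_span_singleton_self _)
    have h2 : w0 + s • d ∈ A ⊔ Submodule.span F {w0 + s • d} :=
      Submodule.mem_sup_right (Submodule.mem_span_singleton_self _)
    have h3 := Submodule.sub_mem _ h1 h2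
    rw [add_sub_add_left_eq_sub, ← sub_smul] at h3
    have hmem : A ⊔ Submodule.span F {w0 + s • d} ∈ {W : Submodule F V |
      Module.finrank F ↥W = e + 1 ∧ Submodule.comap H.subtype W = U ∧ ¬ W ⊓ W' ≤ H} := by
      rw [hset]; exact ⟨s, rfl⟩
    have h4 := (hcomap _).1 hmem.2.1
    have h5 : (t - s) • d ∈ A := by
      rw [← h4]; exact ⟨H.smul_mem _ hd.1, h3⟩
    by_contra hne
    exact hdA ((A.smul_mem_iff (sub_ne_zero.2 hne)).1 h5)
  rw [hset, ← Set.image_univ, Set.ncard_image_of_injective _ hinj, Set.ncard_univ,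
    Nat.card_eq_fintype_card, hq]
end

section
/- The switched graph Γ̃ is cospectral with the Grassmann graph J_q(2e+1,e+1): the adjacency matrices of Γ̃ and of J_q(2e+1,e+1) have the same characteristic polynomial. Consequently the twisted Grassmann graph is cospectral with the Grassmann graph J_q(2e+1,e+1). -/
/-- The Grassmann graph `J_q(2e+1,e+1)`: vertices are the `(e+1)`-dimensional subspaces
of `V`, two subspaces being adjacent iff their intersection has dimension `e`. -/
def grassmannGraph {F V : Type*} [Field F] [AddCommGroup V] [Module F V] (e : ℕ) :
    SimpleGraph {W : Submodule F V // Module.finrank F ↥W = e + 1} :=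
  SimpleGraph.fromRel fun W₁ W₂ => Module.finrank F ↥(W₁.1 ⊓ W₂.1) = e

set_option linter.unusedSectionVars false

lemma tg_matrix {n m : Type*} [Fintype n] [Fintype m] [DecidableEq n] [DecidableEq m]
    (X0 : Matrix n n ℚ) (P : Matrix n m ℚ) (B : Matrix m n ℚ) (S R : Matrix m m ℚ) (c : ℚ)
    (hc : c ≠ 0) (hP : P.transpose * P = c • (1 : Matrix m m ℚ)) (hS : S * S = 1)
    (hX : X0 * P = P * R) (hX' : P.transpose * X0 = R * P.transpose) (hR : R * S = S * R)
    (hB : B * P = 0) (hB' : P.transpose * B.transpose = 0) :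
    (X0 + P * S * B + B.transpose * S * P.transpose).charpoly =
      (X0 + P * B + B.transpose * P.transpose).charpoly := by
  obtain ⟨Q, hQ⟩ : ∃ Q : Matrix n n ℚ, Q = 1 + c⁻¹ • (P * (S - 1) * P.transpose) := ⟨_, rfl⟩
  have hQP : Q * P = P * S := by
    rw [hQ, Matrix.add_mul, Matrix.smul_mul, Matrix.mul_assoc _ _ P, hP, Matrix.mul_smul, smul_smul,
      inv_mul_cancel₀ hc]
    simp [Matrix.mul_sub]
  have hPQ : P.transpose * Q = S * P.transpose := by
    rw [hQ, Matrix.mul_add, Matrix.mul_smul, Matrix.mul_assoc P, ← Matrix.mul_assoc _ P, hP,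
      Matrix.smul_mul, smul_smul, inv_mul_cancel₀ hc]
    simp [Matrix.sub_mul]
  have hBQ : B * Q = B := by
    rw [hQ, Matrix.mul_add, Matrix.mul_smul, Matrix.mul_assoc P, ← Matrix.mul_assoc B, hB]; simp
  have hQB : Q * B.transpose = B.transpose := by
    rw [hQ, Matrix.add_mul, Matrix.smul_mul, Matrix.mul_assoc _ _ B.transpose, hB']; simp
  have hQQ : Q * Q = 1 := by
    conv_lhs => enter [1]; rw [hQ]
    rw [Matrix.add_mul, Matrix.smul_mul, Matrix.mul_assoc _ _ Q, hPQ]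
    rw [Matrix.mul_assoc P, ← Matrix.mul_assoc _ S, Matrix.sub_mul, hS, one_mul, one_mul, hQ,
      ← neg_sub S 1, Matrix.neg_mul, Matrix.mul_neg, ← Matrix.mul_assoc]
    simp
  have hQX : Q * X0 = X0 * Q := by
    have h1 : (S - 1) * R = R * (S - 1) := by
      rw [Matrix.sub_mul, Matrix.mul_sub, hR, Matrix.one_mul, Matrix.mul_one]
    have h2 : P * (S - 1) * P.transpose * X0 = X0 * (P * (S - 1) * P.transpose) := by
      rw [Matrix.mul_assoc _ _ X0, hX', ← Matrix.mul_assoc, Matrix.mul_assoc P, h1,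
        ← Matrix.mul_assoc P, ← hX, Matrix.mul_assoc X0, Matrix.mul_assoc X0]
    rw [hQ, Matrix.add_mul, Matrix.mul_add, Matrix.smul_mul, Matrix.mul_smul, h2,
      Matrix.one_mul, Matrix.mul_one]
  let u : (Matrix n n ℚ)ˣ := ⟨Q, Q, hQQ, hQQ⟩
  rw [← Matrix.charpoly_units_conj u (X0 + P * B + B.transpose * P.transpose)]
  congr 1
  have hu : (u : Matrix n n ℚ)⁻¹ = Q := by
    rw [← Matrix.coe_units_inv]; rfl
  have hu1 : (u : Matrix n n ℚ) = Q := rfl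
  rw [hu, hu1]
  rw [Matrix.mul_add, Matrix.mul_add, Matrix.add_mul, Matrix.add_mul, hQX, Matrix.mul_assoc X0, hQQ, mul_one,
    ← Matrix.mul_assoc Q P, hQP, Matrix.mul_assoc _ B, hBQ, ← Matrix.mul_assoc Q B.transpose, hQB,
    Matrix.mul_assoc _ _ Q, hPQ, ← Matrix.mul_assoc]

section
variable {F V : Type*} [Field F] [AddCommGroup V] [Module F V] [FiniteDimensional F V]

lemma tg_sigma_aux (σ : Submodule F V → Submodule F V)
    (hσinv : ∀ U, σ (σ U) = U) (hσanti : ∀ U U', U ≤ U' → σ U' ≤ σ U) (k : ℕ) :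
    ∀ U : Submodule F V, Module.finrank F V ≤ Module.finrank F U + k → k ≤ Module.finrank F V →
      Module.finrank F V ≤ Module.finrank F U + Module.finrank F (σ U) := by
  induction k with
  | zero => intro U h _; omega
  | succ k ih =>
    intro U h hk
    by_cases hU : U = ⊤
    · rw [hU, finrank_top]; omega
    obtain ⟨v, hv⟩ : ∃ v, v ∉ U := by
      by_contra! h
      exact hU (by ext; simp [h])
    have hlt : U < U ⊔ Submodule.span F {v} := by
      refine lt_of_le_of_ne le_sup_left fun h => hv ?_
      rw [h]
      exact Submodule.mem_sup_right (Submodule.mem_span_singleton_self v)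
    have h1 := Submodule.finrank_lt_finrank_of_lt hlt
    have h2 := Submodule.finrank_add_le_finrank_add_finrank U (Submodule.span F {v})
    have h3 := finrank_span_singleton (K := F) (v := v) (by rintro rfl; exact hv U.zero_mem)
    have h4 := ih (U ⊔ Submodule.span F {v}) (by omega) (by omega)
    have h5 : σ (U ⊔ Submodule.span F {v}) < σ U := by
      refine lt_of_le_of_ne (hσanti _ _ hlt.le) fun h => hlt.ne ?_
      have := congrArg σ h
      rw [hσinv, hσinv] at this
      exact this.symm
    have h6 := Submodule.finrank_lt_finrank_of_lt h5
    omega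

lemma tg_sigma_inf (σ : Submodule F V → Submodule F V)
    (hσinv : ∀ U, σ (σ U) = U) (hσanti : ∀ U U', U ≤ U' → σ U' ≤ σ U) (U U' : Submodule F V) :
    σ U ⊓ σ U' = σ (U ⊔ U') := by
  apply le_antisymm
  · have h1 : U ≤ σ (σ U ⊓ σ U') := by
      conv_lhs => rw [← hσinv U]
      exact hσanti _ _ inf_le_left
    have h2 : U' ≤ σ (σ U ⊓ σ U') := by
      conv_lhs => rw [← hσinv U']
      exact hσanti _ _ inf_le_right
    have := hσanti _ _ (sup_le h1 h2)
    rwa [hσinv] at this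
  · exact le_inf (hσanti _ _ le_sup_left) (hσanti _ _ le_sup_right)

lemma tg_sigma_finrank (σ : Submodule F V → Submodule F V)
    (hσinv : ∀ U, σ (σ U) = U) (hσanti : ∀ U U', U ≤ U' → σ U' ≤ σ U) (U : Submodule F V) :
    Module.finrank F U + Module.finrank F (σ U) = Module.finrank F V := by
  have key : ∀ U : Submodule F V, Module.finrank F V ≤ Module.finrank F U + Module.finrank F (σ U) := fun U =>
    tg_sigma_aux σ hσinv hσanti _ U (Nat.le_add_left _ _) le_rfl
  obtain ⟨U', hU'⟩ := Submodule.exists_isCompl U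
  have h1 : σ U ⊓ σ U' = ⊥ := by
    rw [tg_sigma_inf σ hσinv hσanti, hU'.sup_eq_top, eq_bot_iff]
    have := hσanti (σ ⊥) ⊤ le_top
    rwa [hσinv] at this
  have h2 := Submodule.finrank_sup_add_finrank_inf_eq (σ U) (σ U')
  rw [h1, finrank_bot] at h2
  have h3 := Submodule.finrank_le (σ U ⊔ σ U')
  have h4 := Submodule.finrank_add_eq_of_isCompl hU'
  have h5 := key U
  have h6 := key U'
  omega

lemma tg_hyper (H : Submodule F V) (hH : Module.finrank F V = Module.finrank F H + 1)
    (Z : Submodule F V) (hZ : ¬ Z ≤ H) :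
    Module.finrank F Z = Module.finrank F ↥(Z ⊓ H) + 1 := by
  have h1 := Submodule.finrank_sup_add_finrank_inf_eq Z H
  have h2 : H < Z ⊔ H := lt_of_le_of_ne le_sup_right fun h => hZ (by rw [h]; exact le_sup_left)
  have h3 := Submodule.finrank_lt_finrank_of_lt h2
  have h4 := Submodule.finrank_le (Z ⊔ H)
  omega

lemma tg_shift (H : Submodule F V) (hH : Module.finrank F V = Module.finrank F H + 1)
    (v w : V) (hv : v ∉ H) (hw : w ∉ H) : ∃ h ∈ H, ∃ t : F, t ≠ 0 ∧ t • w = v + h := by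
  have h2 : H < Submodule.span F {w} ⊔ H := by
    refine lt_of_le_of_ne le_sup_right fun h => hw ?_
    rw [h]
    exact Submodule.mem_sup_left (Submodule.mem_span_singleton_self w)
  have h3 := Submodule.finrank_lt_finrank_of_lt h2
  have h4 := Submodule.finrank_le (Submodule.span F {w} ⊔ H)
  have h5 : Submodule.span F {w} ⊔ H = ⊤ := Submodule.eq_top_of_finrank_eq (by omega)
  have h6 : v ∈ Submodule.span F {w} ⊔ H := by rw [h5]; trivial
  obtain ⟨a, ha, b, hb, hab⟩ := Submodule.mem_sup.1 h6
  obtain ⟨t, rfl⟩ := Submodule.mem_span_singleton.1 ha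
  refine ⟨-b, H.neg_mem hb, t, ?_, ?_⟩
  · rintro rfl
    apply hv
    rw [← hab]; simpa using hb
  · rw [← hab]; abel

lemma tg_mem_phi {U : Submodule F V} {x z : V} :
    z ∈ U ⊔ Submodule.span F {x} ↔ ∃ t : F, z - t • x ∈ U := by
  rw [Submodule.mem_sup]
  constructor
  · rintro ⟨y, hy, a, ha, rfl⟩
    obtain ⟨t, rfl⟩ := Submodule.mem_span_singleton.1 ha
    exact ⟨t, by simpa using hy⟩
  · rintro ⟨t, ht⟩
    exact ⟨_, ht, t • x, Submodule.mem_span_singleton.2 ⟨t, rfl⟩, by abel⟩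

lemma tg_coef {H : Submodule F V} {x : V} (hx : x ∉ H) {t : F} (h : t • x ∈ H) : t = 0 := by
  by_contra ht
  exact hx ((H.smul_mem_iff ht).1 h)

lemma tg_phi_not_le {H U : Submodule F V} {x : V} (hx : x ∉ H) :
    ¬ U ⊔ Submodule.span F {x} ≤ H := fun h =>
  hx (h (Submodule.mem_sup_right (Submodule.mem_span_singleton_self x)))

lemma tg_phi_inf {H U : Submodule F V} (hU : U ≤ H) {x : V} (hx : x ∉ H) :
    (U ⊔ Submodule.span F {x}) ⊓ H = U := by
  apply le_antisymm
  · rintro z ⟨hz, hzH⟩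
    obtain ⟨t, ht⟩ := tg_mem_phi.1 hz
    have : t = 0 := tg_coef hx (by simpa using H.sub_mem hzH (hU ht))
    simpa [this] using ht
  · exact le_inf le_sup_left hU

lemma tg_add_not_mem {H : Submodule F V} {v h : V} (hv : v ∉ H) (hh : h ∈ H) : v + h ∉ H :=
  fun hx => hv (by simpa using H.sub_mem hx hh)

lemma tg_phi_eq {H U : Submodule F V} (hU : U ≤ H) {v h h' : V} (hv : v ∉ H)
    (hh : h ∈ H) (hh' : h' ∈ H) :
    U ⊔ Submodule.span F {v + h} = U ⊔ Submodule.span F {v + h'} ↔ h - h' ∈ U := by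
  have key : ∀ a b : V, a - b ∈ U →
      U ⊔ Submodule.span F {v + a} ≤ U ⊔ Submodule.span F {v + b} := by
    intro a b hab
    refine sup_le le_sup_left ?_
    rw [Submodule.span_singleton_le_iff_mem, tg_mem_phi]
    exact ⟨1, by simpa using hab⟩
  constructor
  · intro heq
    have h1 : v + h ∈ U ⊔ Submodule.span F {v + h'} := by
      rw [← heq]; exact Submodule.mem_sup_right (Submodule.mem_span_singleton_self _)
    have h2 : v + h' ∈ U ⊔ Submodule.span F {v + h'} :=
      Submodule.mem_sup_right (Submodule.mem_span_singleton_self _)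
    rw [← tg_phi_inf hU (tg_add_not_mem hv hh')]
    exact ⟨by simpa using Submodule.sub_mem _ h1 h2, H.sub_mem hh hh'⟩
  · intro hm
    exact le_antisymm (key _ _ hm) (key _ _ (by simpa using U.neg_mem hm))

lemma tg_phi_surj {H : Submodule F V} (hH : Module.finrank F V = Module.finrank F H + 1)
    {v : V} (hv : v ∉ H) {W : Submodule F V} (hW : ¬ W ≤ H) :
    ∃ h ∈ H, W = (W ⊓ H) ⊔ Submodule.span F {v + h} := by
  obtain ⟨w, hwW, hwH⟩ := Set.not_subset.1 hW
  obtain ⟨h, hh, t, ht, htw⟩ := tg_shift H hH v w hv hwH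
  refine ⟨h, hh, ?_⟩
  symm
  have hle : (W ⊓ H) ⊔ Submodule.span F {v + h} ≤ W := by
    refine sup_le inf_le_left ?_
    rw [Submodule.span_singleton_le_iff_mem, ← htw]
    exact W.smul_mem t hwW
  apply Submodule.eq_of_le_of_finrank_eq hle
  rw [tg_hyper H hH W hW, tg_hyper H hH _ (tg_phi_not_le (tg_add_not_mem hv hh)),
    tg_phi_inf inf_le_right (tg_add_not_mem hv hh)]

lemma tg_meet {H U' W : Submodule F V} (hU' : U' ≤ H) {v h : V} (hv : v ∉ H) (hvW : v ∈ W)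
    (hh : h ∈ H) :
    ¬ W ⊓ (U' ⊔ Submodule.span F {v + h}) ≤ H ↔ h ∈ (W ⊓ H) ⊔ U' := by
  constructor
  · intro hn
    obtain ⟨z, ⟨hzW, hz⟩, hzH⟩ := Set.not_subset.1 hn
    obtain ⟨t, ht⟩ := tg_mem_phi.1 hz
    have ht0 : t ≠ 0 := by
      rintro rfl
      exact hzH (hU' (by simpa using ht))
    have h1 : z - t • v ∈ W := W.sub_mem hzW (W.smul_mem t hvW)
    have h2 : z - t • v ∈ H := by
      have := H.add_mem (hU' ht) (H.smul_mem t hh)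
      rw [smul_add] at this
      convert this using 1
      abel
    have h3 : t • h ∈ (W ⊓ H) ⊔ U' := by
      have := Submodule.sub_mem ((W ⊓ H) ⊔ U') (Submodule.mem_sup_left ⟨h1, h2⟩)
        (Submodule.mem_sup_right ht)
      rw [smul_add] at this
      convert this using 1
      abel
    exact (Submodule.smul_mem_iff _ ht0).1 h3
  · intro hm hle
    obtain ⟨a, ⟨haW, haH⟩, b, hb, rfl⟩ := Submodule.mem_sup.1 hm
    refine tg_add_not_mem hv haH (hle ⟨W.add_mem hvW haW, tg_mem_phi.2 ⟨1, ?_⟩⟩)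
    have := U'.neg_mem hb
    convert this using 1
    simp
end

section
variable {F V : Type*} [Field F] [Fintype F] [AddCommGroup V] [Module F V]
  [FiniteDimensional F V] [Fintype V]

open scoped Classical in
lemma tg_card_sub (K : Submodule F V) :
    (Finset.univ.filter fun h : V => h ∈ K).card = Fintype.card F ^ Module.finrank F K := by
  rw [← Module.card_eq_pow_finrank (K := F) (V := K), Fintype.card_subtype]

open scoped Classical in
lemma tg_fiber_count (e : ℕ) (H : Submodule F V)
    (hH : Module.finrank F V = Module.finrank F H + 1) (v : V) (hv : v ∉ H)
    (U : Submodule F V) (hUH : U ≤ H) (hU : Module.finrank F U = e) (p : Submodule F V → Prop) :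
    (Finset.univ.filter fun W : {W : Submodule F V // Module.finrank F ↥W = e + 1} =>
      ¬ W.1 ≤ H ∧ W.1 ⊓ H = U ∧ p W.1).card * Fintype.card F ^ e =
    (Finset.univ.filter fun h : V => h ∈ H ∧ p (U ⊔ Submodule.span F {v + h})).card := by
  have hrk : ∀ h ∈ H, Module.finrank F ↥(U ⊔ Submodule.span F {v + h}) = e + 1 := by
    intro h hh
    rw [tg_hyper H hH _ (tg_phi_not_le (tg_add_not_mem hv hh)),
      tg_phi_inf hUH (tg_add_not_mem hv hh), hU]
  let g : V → {W : Submodule F V // Module.finrank F ↥W = e + 1} := fun h =>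
    if hh : h ∈ H then ⟨_, hrk h hh⟩ else ⟨_, hrk 0 H.zero_mem⟩
  have hg : ∀ h ∈ H, (g h).1 = U ⊔ Submodule.span F {v + h} := by
    intro h hh
    simp [g, hh]
  rw [Finset.card_eq_sum_card_fiberwise (f := g) (t := Finset.univ.filter
    fun W : {W : Submodule F V // Module.finrank F ↥W = e + 1} =>
      ¬ W.1 ≤ H ∧ W.1 ⊓ H = U ∧ p W.1)]
  · rw [Finset.sum_const_nat]
    intro W hW
    simp only [Finset.mem_filter, Finset.mem_univ, true_and] at hW
    obtain ⟨hW1, hW2, hW3⟩ := hW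
    obtain ⟨h0, hh0, hWe⟩ := tg_phi_surj hH hv hW1
    rw [hW2] at hWe
    have hcU : Fintype.card F ^ e = _ := hU ▸ (tg_card_sub U).symm
    rw [hcU]
    symm
    refine Finset.card_bij (fun h _ => h + h0) ?_ ?_ ?_
    · intro a ha
      simp only [Finset.mem_filter, Finset.mem_univ, true_and] at ha ⊢
      have haH := H.add_mem (hUH ha) hh0
      have heq : U ⊔ Submodule.span F {v + (a + h0)} = W.1 := by
        rw [hWe, tg_phi_eq hUH hv haH hh0]
        simpa using ha
      exact ⟨⟨haH, by rw [heq]; exact hW3⟩, Subtype.ext (by rw [hg _ haH, heq])⟩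
    · intro a _ b _ hab
      simpa using hab
    · intro b hb
      simp only [Finset.mem_filter, Finset.mem_univ, true_and] at hb
      refine ⟨b - h0, ?_, by abel⟩
      simp only [Finset.mem_filter, Finset.mem_univ, true_and]
      rw [← tg_phi_eq hUH hv hb.1.1 hh0, ← hWe, ← hg _ hb.1.1, hb.2]
  · intro h hh
    simp only [Finset.coe_filter, Finset.mem_univ, true_and, Set.mem_ofPred_eq] at hh ⊢
    rw [hg _ hh.1]
    exact ⟨tg_phi_not_le (tg_add_not_mem hv hh.1), tg_phi_inf hUH (tg_add_not_mem hv hh.1), hh.2⟩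

lemma tg_exists_not_mem (H : Submodule F V)
    (hH : Module.finrank F V = Module.finrank F H + 1) : ∃ v, v ∉ H := by
  by_contra! h
  have : H = ⊤ := by ext; simp [h]
  rw [this, finrank_top] at hH
  omega

open scoped Classical in
lemma tg_count1 (e : ℕ) (hV : Module.finrank F V = 2 * e + 1) (H : Submodule F V)
    (hH : Module.finrank F H = 2 * e)
    (U : Submodule F V) (hUH : U ≤ H) (hU : Module.finrank F U = e) :
    (Finset.univ.filter fun W : {W : Submodule F V // Module.finrank F ↥W = e + 1} =>
      ¬ W.1 ≤ H ∧ W.1 ⊓ H = U).card = Fintype.card F ^ e := by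
  have hH' : Module.finrank F V = Module.finrank F H + 1 := by omega
  obtain ⟨v, hv⟩ := tg_exists_not_mem H hH'
  have h := tg_fiber_count e H hH' v hv U hUH hU (fun _ => True)
  simp only [and_true] at h
  rw [tg_card_sub, hH, two_mul, pow_add] at h
  exact Nat.eq_of_mul_eq_mul_right (pow_pos Fintype.card_pos e) h

open scoped Classical in
lemma tg_count2 (e : ℕ) (he : 1 ≤ e) (hV : Module.finrank F V = 2 * e + 1) (H : Submodule F V)
    (hH : Module.finrank F H = 2 * e)
    (U : Submodule F V) (hUH : U ≤ H) (hU : Module.finrank F U = e)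
    (W : {W : Submodule F V // Module.finrank F ↥W = e + 1}) (hW : ¬ W.1 ≤ H) :
    (Finset.univ.filter fun W' : {W : Submodule F V // Module.finrank F ↥W = e + 1} =>
      ¬ W'.1 ≤ H ∧ W'.1 ⊓ H = U ∧ (W ≠ W' ∧ Module.finrank F ↥(W.1 ⊓ W'.1) = e)).card =
    if W.1 ⊓ H = U then Fintype.card F ^ e - 1 else
    if Module.finrank F ↥((W.1 ⊓ H) ⊓ U) = e - 1 then Fintype.card F else 0 := by
  have hH' : Module.finrank F V = Module.finrank F H + 1 := by omega
  have hWU : Module.finrank F ↥(W.1 ⊓ H) = e := by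
    have := tg_hyper H hH' W.1 hW
    have := W.2
    omega
  split_ifs with h1 h2
  · rw [← tg_count1 e hV H hH U hUH hU, ← Finset.card_erase_of_mem (a := W) (by simp [hW, h1])]
    congr 1
    ext W'
    simp only [Finset.mem_filter, Finset.mem_univ, true_and, Finset.mem_erase]
    constructor
    · rintro ⟨a, b, c, d⟩
      exact ⟨c.symm, a, b⟩
    · rintro ⟨c, a, b⟩
      refine ⟨a, b, c.symm, ?_⟩
      have hle : U ≤ W.1 ⊓ W'.1 := le_inf (h1 ▸ inf_le_left) (b ▸ inf_le_left)
      have h3 := Submodule.finrank_mono hle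
      have h4 : Module.finrank F ↥(W.1 ⊓ W'.1) < e + 1 := by
        by_contra! h5
        have h6 : W.1 ⊓ W'.1 = W.1 := Submodule.eq_of_le_of_finrank_le inf_le_left (by
          rw [W.2]; exact h5)
        have h7 : W.1 ⊓ W'.1 = W'.1 := Submodule.eq_of_le_of_finrank_le inf_le_right (by
          rw [W'.2]; exact h5)
        exact c (Subtype.ext (h7.symm.trans h6))
      omega
  all_goals
    obtain ⟨v, hvW, hv⟩ := Set.not_subset.1 hW
    have hlt : Module.finrank F ↥((W.1 ⊓ H) ⊓ U) < e := by
      by_contra! h5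
      have h6 : (W.1 ⊓ H) ⊓ U = W.1 ⊓ H :=
        Submodule.eq_of_le_of_finrank_le inf_le_left (by omega)
      have h7 : (W.1 ⊓ H) ⊓ U = U :=
        Submodule.eq_of_le_of_finrank_le inf_le_right (by omega)
      exact h1 (h6.symm.trans h7)
    have key : ∀ W' : Submodule F V, W' ⊓ H = U → (Module.finrank F ↥(W.1 ⊓ W') = e ↔
        (¬ W.1 ⊓ W' ≤ H ∧ Module.finrank F ↥((W.1 ⊓ H) ⊓ U) = e - 1)) := by
      intro W' hW'
      have hii : (W.1 ⊓ H) ⊓ U = (W.1 ⊓ W') ⊓ H := by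
        rw [← hW', ← inf_inf_distrib_right]
      constructor
      · intro h
        have hn : ¬ W.1 ⊓ W' ≤ H := by
          intro hle
          rw [hii, inf_eq_left.2 hle] at hlt
          omega
        have := tg_hyper H hH' _ hn
        rw [hii]
        exact ⟨hn, by omega⟩
      · rintro ⟨hn, h⟩
        rw [tg_hyper H hH' _ hn, ← hii, h]
        omega
    have hne : ∀ W' : {W : Submodule F V // Module.finrank F ↥W = e + 1}, W'.1 ⊓ H = U →
        W ≠ W' := by
      rintro W' h rfl
      exact h1 h
  · have h := tg_fiber_count e H hH' v hv U hUH hU (fun W' => Module.finrank F ↥(W.1 ⊓ W') = e)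
    have hl : (Finset.univ.filter fun W' : {W : Submodule F V // Module.finrank F ↥W = e + 1} =>
        ¬ W'.1 ≤ H ∧ W'.1 ⊓ H = U ∧ (W ≠ W' ∧ Module.finrank F ↥(W.1 ⊓ W'.1) = e)) =
        (Finset.univ.filter fun W' : {W : Submodule F V // Module.finrank F ↥W = e + 1} =>
        ¬ W'.1 ≤ H ∧ W'.1 ⊓ H = U ∧ Module.finrank F ↥(W.1 ⊓ W'.1) = e) := by
      ext W'
      simp only [Finset.mem_filter, Finset.mem_univ, true_and]
      constructor
      · rintro ⟨a, b, _, d⟩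
        exact ⟨a, b, d⟩
      · rintro ⟨a, b, d⟩
        exact ⟨a, b, hne W' b, d⟩
    have hr : (Finset.univ.filter fun h : V => h ∈ H ∧
        Module.finrank F ↥(W.1 ⊓ (U ⊔ Submodule.span F {v + h})) = e) =
        (Finset.univ.filter fun h : V => h ∈ (W.1 ⊓ H) ⊔ U) := by
      ext x
      simp only [Finset.mem_filter, Finset.mem_univ, true_and]
      constructor
      · rintro ⟨a, b⟩
        exact (tg_meet hUH hv hvW a).1 ((key _ (tg_phi_inf hUH (tg_add_not_mem hv a))).1 b).1
      · intro hx
        have a : x ∈ H := (sup_le inf_le_right hUH : (W.1 ⊓ H) ⊔ U ≤ H) hx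
        exact ⟨a, (key _ (tg_phi_inf hUH (tg_add_not_mem hv a))).2
          ⟨(tg_meet hUH hv hvW a).2 hx, h2⟩⟩
    have h' : (Finset.univ.filter
        fun W' : {W : Submodule F V // Module.finrank F ↥W = e + 1} =>
        ¬ W'.1 ≤ H ∧ W'.1 ⊓ H = U ∧ Module.finrank F ↥(W.1 ⊓ W'.1) = e).card *
        Fintype.card F ^ e = (Finset.univ.filter fun h : V => h ∈ H ∧
        Module.finrank F ↥(W.1 ⊓ (U ⊔ Submodule.span F {v + h})) = e).card := by
      convert h
    clear h
    rename' h' => h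
    rw [hr, tg_card_sub] at h
    have h3 := Submodule.finrank_sup_add_finrank_inf_eq (W.1 ⊓ H) U
    have h4 : Module.finrank F ↥((W.1 ⊓ H) ⊔ U) = 1 + e := by omega
    rw [h4, pow_add, pow_one] at h
    rw [hl]
    exact Nat.eq_of_mul_eq_mul_right (pow_pos Fintype.card_pos e) h
  · rw [Finset.card_eq_zero, Finset.filter_eq_empty_iff]
    rintro W' _ ⟨a, b, c, d⟩
    exact h2 ((key _ b).1 d).2
end

lemma tg_fc {F V : Type*} [Field F] [AddCommGroup V] [Module F V] (A B : Submodule F V) :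
    Module.finrank F ↥(A ⊓ B) = Module.finrank F ↥(B ⊓ A) := by
  rw [inf_comm]

section
variable {F V : Type*} [Field F] [Fintype F] [AddCommGroup V] [Module F V]
  [FiniteDimensional F V] [Fintype V]


lemma tg_comap_iff (H W : Submodule F V) (U : Submodule F H) :
    Submodule.comap H.subtype W = U ↔ W ⊓ H = Submodule.map H.subtype U := by
  rw [inf_comm, ← Submodule.map_comap_subtype]
  exact (Submodule.map_injective_of_injective H.injective_subtype).eq_iff.symm

lemma tg_comap_finrank (H W : Submodule F V) :
    Module.finrank F ↥(Submodule.comap H.subtype W) = Module.finrank F ↥(W ⊓ H) := by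
  rw [inf_comm, ← Submodule.map_comap_subtype, Submodule.finrank_map_subtype_eq]

lemma tg_mem_m {e : ℕ} {H W : Submodule F V}
    (hH : Module.finrank F V = Module.finrank F H + 1)
    (hW : Module.finrank F W = e + 1) (hWH : ¬ W ≤ H) :
    Module.finrank F ↥(Submodule.comap H.subtype W) = e := by
  have := tg_hyper H hH W hWH
  rw [tg_comap_finrank]
  omega

lemma tg_sigma_sup_finrank {e : ℕ} {H : Submodule F V} (hH : Module.finrank F H = 2 * e)
    (σ : Submodule F H → Submodule F H)
    (hσinv : ∀ U, σ (σ U) = U) (hσanti : ∀ U U', U ≤ U' → σ U' ≤ σ U) (U U' : Submodule F H) :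
    Module.finrank F ↥(σ U ⊓ σ U') + (Module.finrank F U + Module.finrank F U') =
      2 * e + Module.finrank F ↥(U ⊓ U') := by
  rw [tg_sigma_inf σ hσinv hσanti]
  have h1 := tg_sigma_finrank σ hσinv hσanti (U ⊔ U')
  have h2 := Submodule.finrank_sup_add_finrank_inf_eq U U'
  omega

open scoped Classical in
noncomputable def tgP (e : ℕ) (H : Submodule F V) :
    Matrix {W : Submodule F V // Module.finrank F ↥W = e + 1}
      {U : Submodule F H // Module.finrank F U = e} ℚ :=
  Matrix.of fun W U => if ¬ W.1 ≤ H ∧ Submodule.comap H.subtype W.1 = U.1 then 1 else 0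

open scoped Classical in
noncomputable def tgB (e : ℕ) (H : Submodule F V) :
    Matrix {U : Submodule F H // Module.finrank F U = e}
      {W : Submodule F V // Module.finrank F ↥W = e + 1} ℚ :=
  Matrix.of fun U W => if W.1 ≤ H ∧ Submodule.map H.subtype U.1 ≤ W.1 then 1 else 0

open scoped Classical in
noncomputable def tgX (e : ℕ) (H : Submodule F V) :
    Matrix {W : Submodule F V // Module.finrank F ↥W = e + 1}
      {W : Submodule F V // Module.finrank F ↥W = e + 1} ℚ :=
  Matrix.of fun W W' => if (W ≠ W' ∧ Module.finrank F ↥(W.1 ⊓ W'.1) = e) ∧ (W.1 ≤ H ↔ W'.1 ≤ H)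
    then 1 else 0

open scoped Classical in
noncomputable def tgR (e : ℕ) (H : Submodule F V) :
    Matrix {U : Submodule F H // Module.finrank F U = e}
      {U : Submodule F H // Module.finrank F U = e} ℚ :=
  Matrix.of fun U U' => if U = U' then (Fintype.card F : ℚ) ^ e - 1 else
    if Module.finrank F ↥(U.1 ⊓ U'.1) = e - 1 then (Fintype.card F : ℚ) else 0

open scoped Classical in
noncomputable def tgS (e : ℕ) (H : Submodule F V) (σ : Submodule F H → Submodule F H) :
    Matrix {U : Submodule F H // Module.finrank F U = e}
      {U : Submodule F H // Module.finrank F U = e} ℚ :=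
  Matrix.of fun U U' => if σ U.1 = U'.1 then 1 else 0

open scoped Classical in
lemma tg_P_mul {e : ℕ} {H : Submodule F V} (hH : Module.finrank F V = Module.finrank F H + 1)
    {k : Type*} (M : Matrix {U : Submodule F H // Module.finrank F U = e} k ℚ)
    (W : {W : Submodule F V // Module.finrank F ↥W = e + 1}) (j : k) :
    (tgP e H * M) W j = if h : W.1 ≤ H then 0 else M ⟨_, tg_mem_m hH W.2 h⟩ j := by
  rw [Matrix.mul_apply]
  split_ifs with h
  · exact Finset.sum_eq_zero fun U _ => by simp [tgP, h]
  · rw [Finset.sum_eq_single ⟨_, tg_mem_m hH W.2 h⟩]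
    · simp [tgP, h]
    · intro U _ hU
      have : ¬ Submodule.comap H.subtype W.1 = U.1 := fun h' => hU (Subtype.ext h'.symm)
      simp [tgP, this]
    · simp

open scoped Classical in
lemma tg_S_mul {e : ℕ} {H : Submodule F V} (σ : Submodule F H → Submodule F H)
    (hσ : ∀ U : Submodule F H, Module.finrank F U = e → Module.finrank F (σ U) = e)
    {k : Type*} (M : Matrix {U : Submodule F H // Module.finrank F U = e} k ℚ)
    (U : {U : Submodule F H // Module.finrank F U = e}) (j : k) :
    (tgS e H σ * M) U j = M ⟨σ U.1, hσ _ U.2⟩ j := by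
  rw [Matrix.mul_apply, Finset.sum_eq_single ⟨σ U.1, hσ _ U.2⟩]
  · simp [tgS]
  · intro U' _ hU
    have : ¬ σ U.1 = U'.1 := fun h' => hU (Subtype.ext h'.symm)
    simp [tgS, this]
  · simp

lemma tg_S_symm {e : ℕ} {H : Submodule F V} (σ : Submodule F H → Submodule F H)
    (hσinv : ∀ U, σ (σ U) = U) : (tgS e H σ).transpose = tgS e H σ := by
  ext U U'
  have : σ U'.1 = U.1 ↔ σ U.1 = U'.1 := by
    constructor
    · intro h; rw [← h, hσinv]
    · intro h; rw [← h, hσinv]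
  simp [tgS, this]

lemma tg_R_symm (e : ℕ) (H : Submodule F V) : (tgR e H).transpose = tgR e H := by
  ext U U'
  simp only [tgR, Matrix.transpose_apply, Matrix.of_apply, tg_fc U'.1 U.1, eq_comm (a := U')]

open scoped Classical in
lemma tg_X_symm (e : ℕ) (H : Submodule F V) : (tgX e H).transpose = tgX e H := by
  ext U U'
  simp only [tgX, Matrix.transpose_apply, Matrix.of_apply]
  refine if_congr ?_ rfl rfl
  rw [tg_fc, ne_comm, iff_comm (a := U'.1 ≤ H)]

open scoped Classical in
lemma tg_BP (e : ℕ) (H : Submodule F V) : tgB e H * tgP e H = 0 := by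
  ext U U'
  rw [Matrix.mul_apply]
  refine Finset.sum_eq_zero fun W _ => ?_
  by_cases h : W.1 ≤ H <;> simp [tgP, tgB, h]

open scoped Classical in
lemma tg_PP {e : ℕ} (hV : Module.finrank F V = 2 * e + 1) {H : Submodule F V}
    (hH : Module.finrank F H = 2 * e) :
    (tgP e H).transpose * tgP e H = ((Fintype.card F : ℚ) ^ e) • 1 := by
  ext U U'
  rw [Matrix.mul_apply]
  by_cases h : U = U'
  · subst h
    have h1 := tg_count1 e hV H hH (Submodule.map H.subtype U.1) (Submodule.map_subtype_le _ _)
      (by rw [Submodule.finrank_map_subtype_eq, U.2])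
    have h2 : (((Fintype.card F ^ e : ℕ)) : ℚ) = (Fintype.card F : ℚ) ^ e := by push_cast; rfl
    simp only [Matrix.smul_apply, Matrix.one_apply_eq, smul_eq_mul, mul_one]
    rw [← h2, ← h1, Finset.card_filter]
    push_cast
    refine Finset.sum_congr rfl fun W _ => ?_
    simp only [tgP, Matrix.transpose_apply, Matrix.of_apply, tg_comap_iff]
    split_ifs <;> simp
  · rw [Matrix.smul_apply, Matrix.one_apply_ne h, smul_zero]
    refine Finset.sum_eq_zero fun W _ => ?_
    simp only [tgP, Matrix.transpose_apply, Matrix.of_apply]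
    by_cases h1 : Submodule.comap H.subtype W.1 = U.1
    · have : ¬ Submodule.comap H.subtype W.1 = U'.1 := fun h' => h (Subtype.ext (h1.symm.trans h'))
      simp [this]
    · simp [h1]

open scoped Classical in
lemma tg_XP {e : ℕ} (he : 1 ≤ e) (hV : Module.finrank F V = 2 * e + 1) {H : Submodule F V}
    (hH : Module.finrank F H = 2 * e) :
    tgX e H * tgP e H = tgP e H * tgR e H := by
  ext W U
  rw [tg_P_mul (by omega), Matrix.mul_apply]
  split_ifs with h
  · refine Finset.sum_eq_zero fun W' _ => ?_
    by_cases h' : W'.1 ≤ H <;> simp [tgP, tgX, h, h']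
  · have h1 := tg_count2 e he hV H hH (Submodule.map H.subtype U.1) (Submodule.map_subtype_le _ _)
      (by rw [Submodule.finrank_map_subtype_eq, U.2]) W h
    have h2 : ∑ W', tgX e H W W' * tgP e H W' U = (((Finset.univ.filter
        fun W' : {W : Submodule F V // Module.finrank F ↥W = e + 1} =>
        ¬ W'.1 ≤ H ∧ W'.1 ⊓ H = Submodule.map H.subtype U.1 ∧
          (W ≠ W' ∧ Module.finrank F ↥(W.1 ⊓ W'.1) = e)).card : ℕ) : ℚ) := by
      rw [Finset.card_filter]
      push_cast
      refine Finset.sum_congr rfl fun W' _ => ?_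
      simp only [tgP, tgX, Matrix.of_apply, tg_comap_iff]
      by_cases h' : W'.1 ≤ H
      · simp [h']
      · simp only [h, h', not_false_eq_true, true_and, and_true, mul_ite, mul_one, mul_zero]
        split_ifs <;> first | rfl | (exfalso; tauto)
    rw [h2, h1]
    have h3 : (⟨_, tg_mem_m (by omega) W.2 h⟩ : {U : Submodule F H // Module.finrank F U = e}) = U ↔
        W.1 ⊓ H = Submodule.map H.subtype U.1 := by
      rw [Subtype.ext_iff, tg_comap_iff]
    have h4 : Module.finrank F ↥(Submodule.comap H.subtype W.1 ⊓ U.1) =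
        Module.finrank F ↥((W.1 ⊓ H) ⊓ Submodule.map H.subtype U.1) := by
      rw [inf_comm W.1 H, ← Submodule.map_comap_subtype H W.1,
        ← Submodule.map_inf _ H.injective_subtype, Submodule.finrank_map_subtype_eq]
    simp only [tgR, Matrix.of_apply, h3, h4]
    have h5 : 1 ≤ Fintype.card F ^ e := Nat.one_le_pow _ _ Fintype.card_pos
    split_ifs <;> push_cast [h5] <;> rfl

open scoped Classical in
lemma tg_RS {e : ℕ} {H : Submodule F V} (hH : Module.finrank F H = 2 * e)
    (σ : Submodule F H → Submodule F H)
    (hσinv : ∀ U, σ (σ U) = U) (hσanti : ∀ U U', U ≤ U' → σ U' ≤ σ U) :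
    tgR e H * tgS e H σ = tgS e H σ * tgR e H := by
  have hσ : ∀ U : Submodule F H, Module.finrank F U = e → Module.finrank F (σ U) = e := by
    intro U hU
    have := tg_sigma_finrank σ hσinv hσanti U
    omega
  have h0 : tgR e H * tgS e H σ = (tgS e H σ * tgR e H).transpose := by
    rw [Matrix.transpose_mul, tg_R_symm, tg_S_symm σ hσinv]
  rw [h0]
  ext U U'
  rw [Matrix.transpose_apply, tg_S_mul σ hσ, tg_S_mul σ hσ]
  have h1 : (⟨σ U'.1, hσ _ U'.2⟩ : {U : Submodule F H // Module.finrank F U = e}) = U ↔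
      ⟨σ U.1, hσ _ U.2⟩ = U' := by
    rw [Subtype.ext_iff, Subtype.ext_iff]
    constructor
    · intro h; simp only at h ⊢; rw [← h, hσinv]
    · intro h; simp only at h ⊢; rw [← h, hσinv]
  have h2 : Module.finrank F ↥(σ U'.1 ⊓ U.1) = Module.finrank F ↥(σ U.1 ⊓ U'.1) := by
    have := tg_sigma_sup_finrank hH σ hσinv hσanti U'.1 (σ U.1)
    rw [hσinv, U'.2, hσ _ U.2, inf_comm U'.1] at this
    omega
  simp only [tgR, Matrix.of_apply, h1, h2]

open scoped Classical in
lemma tg_grass_eq {e : ℕ} (hV : Module.finrank F V = 2 * e + 1) {H : Submodule F V}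
    (hH : Module.finrank F H = 2 * e) :
    (grassmannGraph (F := F) (V := V) e).adjMatrix ℚ =
      tgX e H + tgP e H * tgB e H + (tgB e H).transpose * (tgP e H).transpose := by
  have hH' : Module.finrank F V = Module.finrank F H + 1 := by omega
  have key : ∀ W W' : {W : Submodule F V // Module.finrank F ↥W = e + 1}, ¬ W.1 ≤ H → W'.1 ≤ H →
      (W ≠ W' ∧ Module.finrank F ↥(W.1 ⊓ W'.1) = e ↔
        Submodule.map H.subtype (Submodule.comap H.subtype W.1) ≤ W'.1) := by
    intro W W' h h'
    have h1 : Module.finrank F ↥(H ⊓ W.1) = e := by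
      have := tg_hyper H hH' W.1 h
      rw [inf_comm]
      have := W.2
      omega
    rw [Submodule.map_comap_subtype]
    have h2 : W.1 ⊓ W'.1 ≤ H ⊓ W.1 := le_inf (inf_le_right.trans h') inf_le_left
    constructor
    · rintro ⟨_, hr⟩
      rw [← Submodule.eq_of_le_of_finrank_eq h2 (by omega)]
      exact inf_le_right
    · intro hle
      refine ⟨fun heq => h (heq ▸ h'), ?_⟩
      rw [le_antisymm h2 (le_inf inf_le_right hle), h1]
  rw [← Matrix.transpose_mul]
  ext W W'
  have hadj : (grassmannGraph (F := F) (V := V) e).Adj W W' ↔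
      W ≠ W' ∧ Module.finrank F ↥(W.1 ⊓ W'.1) = e := by
    simp only [grassmannGraph, SimpleGraph.fromRel_adj, tg_fc W'.1 W.1, or_self]
  simp only [SimpleGraph.adjMatrix_apply, Matrix.add_apply, Matrix.transpose_apply,
    tg_P_mul hH', hadj]
  by_cases h : W.1 ≤ H <;> by_cases h' : W'.1 ≤ H
  · simp [tgX, h, h']
  · have := key W' W h' h
    rw [tg_fc, ne_comm] at this
    simp only [this]
    simp [tgX, tgB, h, h']
  · simp only [key W W' h h']
    simp [tgX, tgB, h, h']
  · simp [tgX, tgB, h, h']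

open scoped Classical in
lemma tg_switched_eq {e : ℕ} (hV : Module.finrank F V = 2 * e + 1) {H : Submodule F V}
    (hH : Module.finrank F H = 2 * e)
    (σ : Submodule F H → Submodule F H)
    (hσinv : ∀ U, σ (σ U) = U) (hσanti : ∀ U U', U ≤ U' → σ U' ≤ σ U) :
    (switchedGraph e H σ).adjMatrix ℚ =
      tgX e H + tgP e H * tgS e H σ * tgB e H +
        (tgB e H).transpose * tgS e H σ * (tgP e H).transpose := by
  have hH' : Module.finrank F V = Module.finrank F H + 1 := by omega
  have hσ : ∀ U : Submodule F H, Module.finrank F U = e → Module.finrank F (σ U) = e := by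
    intro U hU
    have := tg_sigma_finrank σ hσinv hσanti U
    omega
  have hT : (tgB e H).transpose * tgS e H σ * (tgP e H).transpose =
      (tgP e H * (tgS e H σ * tgB e H)).transpose := by
    rw [Matrix.transpose_mul, Matrix.transpose_mul, tg_S_symm σ hσinv]
  have hne : ∀ W W' : {W : Submodule F V // Module.finrank F ↥W = e + 1}, ¬ W.1 ≤ H → W'.1 ≤ H →
      W ≠ W' := by
    rintro W W' h h' rfl
    exact h h'
  rw [hT, Matrix.mul_assoc]
  ext W W'
  rw [SimpleGraph.adjMatrix_apply]
  simp only [Matrix.add_apply, Matrix.transpose_apply,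
    tg_P_mul hH', tg_S_mul σ hσ, switchedGraph, SimpleGraph.fromRel_adj, tg_fc W'.1 W.1]
  by_cases h : W.1 ≤ H <;> by_cases h' : W'.1 ≤ H
  · simp [tgX, h, h']
  · have := hne W' W h' h
    simp [tgX, tgB, h, h', this.symm, tg_mem_m hH' W'.2 h']
  · have := hne W W' h h'
    simp [tgX, tgB, h, h', this, tg_mem_m hH' W.2 h]
  · simp [tgX, tgB, h, h']

open scoped Classical in
lemma tg_switched (e : ℕ) (he : 1 ≤ e) (hV : Module.finrank F V = 2 * e + 1)
    (H : Submodule F V) (hH : Module.finrank F ↥H = 2 * e)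
    (σ : Submodule F ↥H → Submodule F ↥H)
    (hσinv : ∀ U, σ (σ U) = U)
    (hσanti : ∀ U U' : Submodule F ↥H, U ≤ U' → σ U' ≤ σ U) :
    ((switchedGraph e H σ).adjMatrix ℤ).charpoly =
      ((grassmannGraph (F := F) (V := V) e).adjMatrix ℤ).charpoly := by
  have hσ : ∀ U : Submodule F H, Module.finrank F U = e → Module.finrank F (σ U) = e := by
    intro U hU
    have := tg_sigma_finrank σ hσinv hσanti U
    omega
  apply Polynomial.map_injective (Int.castRingHom ℚ) Int.cast_injective
  rw [← Matrix.charpoly_map, ← Matrix.charpoly_map]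
  have hmap : ∀ G : SimpleGraph {W : Submodule F V // Module.finrank F ↥W = e + 1},
      (G.adjMatrix ℤ).map (Int.castRingHom ℚ) = G.adjMatrix ℚ := by
    intro G
    ext W W'
    simp only [Matrix.map_apply, SimpleGraph.adjMatrix_apply]
    split_ifs <;> simp
  rw [hmap, hmap, tg_grass_eq hV hH, tg_switched_eq hV hH σ hσinv hσanti]
  refine tg_matrix (tgX e H) (tgP e H) (tgB e H) (tgS e H σ) (tgR e H) ((Fintype.card F : ℚ) ^ e)
    (pow_ne_zero _ (by exact_mod_cast Fintype.card_ne_zero)) (tg_PP hV hH) ?_ (tg_XP he hV hH) ?_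
    (tg_RS hH σ hσinv hσanti) (tg_BP e H) ?_
  · ext U U'
    rw [tg_S_mul σ hσ]
    simp only [tgS, Matrix.of_apply, hσinv, Matrix.one_apply, Subtype.ext_iff]
  · rw [← tg_X_symm, ← Matrix.transpose_mul, tg_XP he hV hH, Matrix.transpose_mul, tg_R_symm]
  · rw [← Matrix.transpose_mul, tg_BP, Matrix.transpose_zero]

open scoped Classical in
lemma tg_twisted (e : ℕ) (he : 1 ≤ e)
    (H : Submodule F V) (hH : Module.finrank F ↥H = 2 * e)
    (σ : Submodule F ↥H → Submodule F ↥H)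
    (hσinv : ∀ U, σ (σ U) = U)
    (hσanti : ∀ U U' : Submodule F ↥H, U ≤ U' → σ U' ≤ σ U)
    (hV : Module.finrank F V = 2 * e + 1) :
    ((twistedGrassmannGraph e H).adjMatrix ℤ).charpoly =
      ((switchedGraph e H σ).adjMatrix ℤ).charpoly := by
  have hH' : Module.finrank F V = Module.finrank F H + 1 := by omega
  have hfr := tg_sigma_finrank σ hσinv hσanti
  have hinj := Submodule.map_injective_of_injective (f := H.subtype) H.injective_subtype
  have hσinj : Function.Injective σ := fun a b h => by rw [← hσinv a, h, hσinv]
  have hle : ∀ U : Submodule F H, Submodule.map H.subtype U ≤ H :=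
    fun U => Submodule.map_subtype_le _ _
  let f : ({W : Submodule F V // Module.finrank F ↥W = e + 1 ∧ ¬ W ≤ H} ⊕
      {U : Submodule F ↥H // Module.finrank F ↥U = e - 1}) →
      {W : Submodule F V // Module.finrank F ↥W = e + 1} :=
    Sum.elim (fun W => ⟨W.1, W.2.1⟩) (fun U => ⟨Submodule.map H.subtype (σ U.1), by
      rw [Submodule.finrank_map_subtype_eq]
      have := hfr U.1
      have := U.2
      omega⟩)
  have hfinj : Function.Injective f := by
    rintro (a | a) (b | b) h
    · have h' : (f (Sum.inl a)).1 = (f (Sum.inl b)).1 := congrArg Subtype.val h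
      exact congrArg Sum.inl (Subtype.ext h')
    · have h' : a.1 = Submodule.map H.subtype (σ b.1) := congrArg Subtype.val h
      exact absurd (h' ▸ hle _) a.2.2
    · have h' : Submodule.map H.subtype (σ a.1) = b.1 := congrArg Subtype.val h
      exact absurd (h' ▸ hle _) b.2.2
    · have h' : Submodule.map H.subtype (σ a.1) = Submodule.map H.subtype (σ b.1) :=
        congrArg Subtype.val h
      exact congrArg Sum.inr (Subtype.ext (hσinj (hinj h')))
  have hfsurj : Function.Surjective f := by
    intro W
    by_cases h : W.1 ≤ H
    · have h1 : Module.finrank F ↥(Submodule.comap H.subtype W.1) = e + 1 := by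
        rw [tg_comap_finrank, inf_eq_left.2 h, W.2]
      refine ⟨Sum.inr ⟨σ (Submodule.comap H.subtype W.1), ?_⟩, Subtype.ext ?_⟩
      · have := hfr (Submodule.comap H.subtype W.1)
        omega
      · simp only [f, Sum.elim_inr, hσinv, Submodule.map_comap_subtype]
        exact inf_eq_right.2 h
    · exact ⟨Sum.inl ⟨W.1, W.2, h⟩, rfl⟩
  let g := Equiv.ofBijective f ⟨hfinj, hfsurj⟩
  have hmix : ∀ (W : Submodule F V) (U : Submodule F H),
      Submodule.map H.subtype U ≤ W ↔ Submodule.map H.subtype (σ (Submodule.comap H.subtype W)) ≤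
        Submodule.map H.subtype (σ U) := by
    intro W U
    rw [Submodule.map_le_map_iff_of_injective H.injective_subtype, Submodule.map_le_iff_le_comap]
    constructor
    · exact hσanti _ _
    · intro h
      have := hσanti _ _ h
      rwa [hσinv, hσinv] at this
  have hadj : ∀ x y, (switchedGraph e H σ).Adj (f x) (f y) ↔
      (twistedGrassmannGraph e H).Adj x y := by
    rintro (a | a) (b | b)
    · have h1 := hfinj.ne_iff (x := Sum.inl a) (y := Sum.inl b)
      simp only [switchedGraph, twistedGrassmannGraph, SimpleGraph.fromRel_adj, h1]
      simp [f, twistedAdj, a.2.2, b.2.2, tg_fc b.1 a.1]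
      intro _
      constructor
      · rintro (h | h)
        · exact h
        · exact (tg_fc a.1 b.1).trans h
      · exact Or.inl
    · have h1 := hfinj.ne_iff (x := Sum.inl a) (y := Sum.inr b)
      simp only [switchedGraph, twistedGrassmannGraph, SimpleGraph.fromRel_adj, h1]
      simp only [f, twistedAdj, Sum.elim_inl, Sum.elim_inr, hmix a.1 b.1]
      have := tg_mem_m hH' a.2.1 a.2.2
      simp [a.2.2, hle, this]
    · have h1 := hfinj.ne_iff (x := Sum.inr a) (y := Sum.inl b)
      simp only [switchedGraph, twistedGrassmannGraph, SimpleGraph.fromRel_adj, h1]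
      simp only [f, twistedAdj, Sum.elim_inl, Sum.elim_inr, hmix b.1 a.1]
      have := tg_mem_m hH' b.2.1 b.2.2
      simp [b.2.2, hle, this]
    · have h1 := hfinj.ne_iff (x := Sum.inr a) (y := Sum.inr b)
      simp only [switchedGraph, twistedGrassmannGraph, SimpleGraph.fromRel_adj, h1]
      have h3 : ∀ A B : Submodule F H, Module.finrank F
          ↥(Submodule.map H.subtype A ⊓ Submodule.map H.subtype B) =
          Module.finrank F ↥(A ⊓ B) := by
        intro A B
        rw [← Submodule.map_inf _ H.injective_subtype, Submodule.finrank_map_subtype_eq]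
      simp only [f, twistedAdj, Sum.elim_inr, tg_fc b.1 a.1, or_self]
      simp only [hle, not_true_eq_false, false_and, and_false, true_and, false_or,
        exists_const, or_false]
      refine and_congr_right fun hne => ?_
      change Module.finrank F
          ↥(Submodule.map H.subtype (σ a.1) ⊓ Submodule.map H.subtype (σ b.1)) = e ∨
        Module.finrank F
          ↥(Submodule.map H.subtype (σ b.1) ⊓ Submodule.map H.subtype (σ a.1)) = e ↔ _
      rw [h3, h3, tg_fc (σ b.1), or_self]
      have h2 := tg_sigma_sup_finrank hH σ hσinv hσanti a.1 b.1
      have ha := a.2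
      have hb := b.2
      have he1 : e ≠ 1 := by
        rintro rfl
        apply hne
        congr 1
        apply Subtype.ext
        rw [Submodule.finrank_eq_zero.1 ha, Submodule.finrank_eq_zero.1 hb]
      omega
  rw [← Matrix.charpoly_reindex g]
  congr 1
  ext x y
  obtain ⟨x, rfl⟩ := g.surjective x
  obtain ⟨y, rfl⟩ := g.surjective y
  simp only [Matrix.reindex_apply, Matrix.submatrix_apply, Equiv.symm_apply_apply,
    SimpleGraph.adjMatrix_apply]
  have := hadj x y
  change _ = if (switchedGraph e H σ).Adj (f x) (f y) then 1 else 0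
  simp only [this]
end

open scoped Classical in
/-- The switched graph `Γ̃` is cospectral with the Grassmann graph
`J_q(2e+1,e+1)`: their adjacency matrices have the same characteristic polynomial.
Consequently the twisted Grassmann graph is cospectral with `J_q(2e+1,e+1)`. -/
theorem stmt_12 {F : Type*} [Field F] [Fintype F]
    {V : Type*} [AddCommGroup V] [Module F V] [FiniteDimensional F V] [Fintype V]
    (e : ℕ) (he : 1 ≤ e) (hV : Module.finrank F V = 2 * e + 1)
    (H : Submodule F V) (hH : Module.finrank F ↥H = 2 * e)
    (σ : Submodule F ↥H → Submodule F ↥H)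
    (hσinv : ∀ U, σ (σ U) = U)
    (hσanti : ∀ U U' : Submodule F ↥H, U ≤ U' → σ U' ≤ σ U) :
    ((switchedGraph e H σ).adjMatrix ℤ).charpoly =
      ((grassmannGraph (F := F) (V := V) e).adjMatrix ℤ).charpoly ∧
    ((twistedGrassmannGraph e H).adjMatrix ℤ).charpoly =
      ((grassmannGraph (F := F) (V := V) e).adjMatrix ℤ).charpoly := by
  exact ⟨tg_switched e he hV H hH σ hσinv hσanti,
    (tg_twisted e he H hH σ hσinv hσanti hV).trans (tg_switched e he hV H hH σ hσinv hσanti)⟩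
end

section
/- (Godsil–McKay switching theorem.) Let Γ be a finite graph with vertex set X, and let {C_1, …, C_t, D} be a partition of X such that {C_1, …, C_t} is an equitable partition of the subgraph of Γ induced on X \ D, and such that every x ∈ D has either 0, |C_i|/2 or |C_i| neighbors in C_i for each i ∈ {1, …, t}. Let Γ̃ be the graph obtained by interchanging adjacency and nonadjacency between x ∈ D and the vertices of C_i whenever x has exactly |C_i|/2 neighbors in C_i, keeping all other adjacencies. Then Γ̃ is cospectral with Γ, i.e., the adjacency matrices of Γ and Γ̃ have the same characteristic polynomial. -/
open scoped Classical in
/-- Core argument over `ℚ`, with the partition encoded by `f` (`none` is the class `D`). -/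
theorem godsil_mckay_aux {X : Type*} [Fintype X] (Γ Γ' : SimpleGraph X) {t : ℕ}
    (f : X → Option (Fin t))
    (heq : ∀ i x y j, f x = some j → f y = some j →
      (∑ z, if f z = some i then Γ.adjMatrix ℚ x z else 0) =
      (∑ z, if f z = some i then Γ.adjMatrix ℚ y z else 0))
    (hhalf : ∀ x i, f x = none →
      (∑ z, if f z = some i then Γ.adjMatrix ℚ x z else 0) = 0 ∨
      2 * (∑ z, if f z = some i then Γ.adjMatrix ℚ x z else 0)
        = (∑ z, if f z = some i then (1 : ℚ) else 0) ∨
      (∑ z, if f z = some i then Γ.adjMatrix ℚ x z else 0)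
        = (∑ z, if f z = some i then (1 : ℚ) else 0))
    (hsame : ∀ x y, (f x = none ∧ f y = none) ∨ (f x ≠ none ∧ f y ≠ none) →
      Γ'.adjMatrix ℚ x y = Γ.adjMatrix ℚ x y)
    (hsw : ∀ x y i, f x = none → f y = some i →
      (2 * (∑ z, if f z = some i then Γ.adjMatrix ℚ x z else 0)
        = (∑ z, if f z = some i then (1 : ℚ) else 0) →
        Γ'.adjMatrix ℚ x y = 1 - Γ.adjMatrix ℚ x y) ∧
      (2 * (∑ z, if f z = some i then Γ.adjMatrix ℚ x z else 0)
        ≠ (∑ z, if f z = some i then (1 : ℚ) else 0) →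
        Γ'.adjMatrix ℚ x y = Γ.adjMatrix ℚ x y)) :
    (Γ'.adjMatrix ℤ).charpoly = (Γ.adjMatrix ℤ).charpoly := by
  set A := Γ.adjMatrix ℚ with hA
  set A' := Γ'.adjMatrix ℚ with hA'
  have symA : ∀ x y, A x y = A y x := fun x y => by
    simp [hA, SimpleGraph.adjMatrix_apply, Γ.adj_comm]
  have symA' : ∀ x y, A' x y = A' y x := fun x y => by
    simp [hA', SimpleGraph.adjMatrix_apply, Γ'.adj_comm]
  have A01 : ∀ x y, 0 ≤ A x y ∧ A x y ≤ 1 := fun x y => by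
    simp only [hA, SimpleGraph.adjMatrix_apply]
    split_ifs <;> norm_num
  clear_value A A'
  obtain ⟨k, hk⟩ : ∃ k : Fin t → ℚ, ∀ i, k i = ∑ z, if f z = some i then (1 : ℚ) else 0 :=
    ⟨_, fun _ => rfl⟩
  obtain ⟨N, hN⟩ : ∃ N : Fin t → X → ℚ, ∀ i x, N i x = ∑ z, if f z = some i then A x z else 0 :=
    ⟨_, fun _ _ => rfl⟩
  simp only [← hk, ← hN] at heq hhalf hsw
  have kpos : ∀ x i, f x = some i → k i ≠ 0 := by
    intro x i hx
    rw [hk, Finset.sum_boole]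
    have : x ∈ Finset.univ.filter (fun z => f z = some i) := by simp [hx]
    exact_mod_cast (Finset.card_pos.mpr ⟨x, this⟩).ne'
  have hN' : ∀ x i, f x = none → (∑ z, if f z = some i then A' x z else 0) = N i x := by
    intro x i hx
    by_cases h : 2 * N i x = k i
    · have : (∑ z, if f z = some i then A' x z else 0)
          = ∑ z, ((if f z = some i then (1 : ℚ) else 0) - (if f z = some i then A x z else 0)) := by
        refine Finset.sum_congr rfl fun z _ => ?_
        split_ifs with hz
        · exact (hsw x z i hx hz).1 h
        · simp
      rw [this, Finset.sum_sub_distrib, ← hk, ← hN]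
      linarith
    · rw [hN]
      refine Finset.sum_congr rfl fun z _ => ?_
      split_ifs with hz
      · exact (hsw x z i hx hz).2 h
      · rfl
  have key : ∀ x y i, f x = none → f y = some i → 2 / k i * N i x = A x y + A' x y := by
    intro x y i hx hy
    have hk0 := kpos y i hy
    by_cases h : 2 * N i x = k i
    · rw [(hsw x y i hx hy).1 h]
      field_simp
      linarith
    · rw [(hsw x y i hx hy).2 h]
      rcases hhalf x i hx with h0 | h0 | h0
      · have : ∀ z ∈ Finset.univ, (if f z = some i then A x z else 0) = 0 := by
          rw [← Finset.sum_eq_zero_iff_of_nonneg, ← hN, h0]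
          intro z _
          split_ifs
          · exact (A01 x z).1
          · exact le_rfl
        have := this y (Finset.mem_univ _)
        rw [if_pos hy] at this
        rw [h0, this]; simp
      · exact absurd h0 h
      · have : ∀ z ∈ Finset.univ,
            ((if f z = some i then (1 : ℚ) else 0) - (if f z = some i then A x z else 0)) = 0 := by
          rw [← Finset.sum_eq_zero_iff_of_nonneg, Finset.sum_sub_distrib, ← hN, ← hk, h0, sub_self]
          intro z _
          split_ifs
          · have := (A01 x z).2
            simpa using this
          · simp
        have := this y (Finset.mem_univ _)
        rw [if_pos hy, if_pos hy] at this
        rw [h0]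
        field_simp
        linarith
  have dbl : ∀ x y i j, f x = some i → f y = some j → k j * N i y = k i * N j x := by
    intro x y i j hx hy
    have e1 : ∀ i j y, f y = some j → k j * N i y
        = ∑ w, ∑ z, if f w = some j ∧ f z = some i then A w z else 0 := by
      intro i j y hy
      rw [hk, Finset.sum_mul]
      refine Finset.sum_congr rfl fun w _ => ?_
      by_cases hw : f w = some j
      · rw [heq i y w j hy hw, hN]
        simp [hw]
      · simp [hw]
    rw [e1 i j y hy, e1 j i x hx, Finset.sum_comm]
    refine Finset.sum_congr rfl fun w _ => Finset.sum_congr rfl fun z _ => ?_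
    rw [symA z w]
    simp only [and_comm]
  let Q : Matrix X X ℚ := Matrix.of fun x y =>
    (if x = y then (if f x = none then 1 else -1) else 0) +
      (f x).elim 0 (fun i => if f y = some i then 2 / k i else 0)
  have Qsym : ∀ x y, Q x y = Q y x := by
    intro x y
    by_cases hxy : x = y
    · rw [hxy]
    · simp only [Q, Matrix.of_apply, hxy, Ne.symm hxy, if_false, zero_add]
      cases hx : f x <;> cases hy : f y <;> simp
      rename_i i j
      by_cases hij : i = j
      · simp [hij]
      · simp [hij, Ne.symm hij]
  have QD : ∀ x (v : X → ℚ), f x = none → ∑ z, Q x z * v z = v x := by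
    intro x v hx
    simp [Q, hx]
  have QC : ∀ x i (v : X → ℚ), f x = some i →
      ∑ z, Q x z * v z = 2 / k i * (∑ z, if f z = some i then v z else 0) - v x := by
    intro x i v hx
    simp only [Q, Matrix.of_apply, hx, Option.elim_some, add_mul, Finset.sum_add_distrib,
      Finset.mul_sum]
    simp
    ring
  have QQ : Q * Q = 1 := by
    ext x y
    rw [Matrix.mul_apply]
    cases hx : f x with
    | none =>
      rw [QD x _ hx]
      simp [Q, hx, Matrix.one_apply]
    | some i =>
      rw [QC x i _ hx]
      have hk0 := kpos x i hx
      have : (∑ z, if f z = some i then Q z y else 0) = if f y = some i then 1 else 0 := by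
        have h1 : (∑ z, if f z = some i then Q z y else 0)
            = ∑ z, Q y z * (if f z = some i then 1 else 0) := by
          refine Finset.sum_congr rfl fun z _ => ?_
          rw [Qsym z y]; simp
        rw [h1]
        cases hy : f y with
        | none => rw [QD y _ hy]; simp [hy]
        | some j =>
          rw [QC y j _ hy]
          by_cases hij : j = i
          · subst hij
            have : (∑ z, if f z = some j then (if f z = some j then (1 : ℚ) else 0) else 0) = k j := by
              rw [hk]
              refine Finset.sum_congr rfl fun z _ => ?_
              split_ifs <;> rfl
            rw [this]
            simp [hy]
            field_simp
            norm_num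
          · have : (∑ z, if f z = some j then (if f z = some i then (1 : ℚ) else 0) else 0) = 0 := by
              refine Finset.sum_eq_zero fun z _ => ?_
              split_ifs with h1 h2
              · rw [h1] at h2; exact absurd (Option.some.inj h2) hij
              · rfl
              · rfl
            rw [this]
            simp [hy, hij]
      rw [this]
      simp only [Q, Matrix.of_apply, hx, Option.elim_some, Matrix.one_apply]
      by_cases hxy : x = y
      · subst hxy; simp [hx]
      · simp [hxy]
  have comm : Q * A = A' * Q := by
    ext x y
    rw [Matrix.mul_apply, Matrix.mul_apply]
    have h1 : ∑ z, A' x z * Q z y = ∑ z, Q y z * A' x z :=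
      Finset.sum_congr rfl fun z _ => by rw [Qsym z y, mul_comm]
    have h2 : ∀ i, (∑ z, if f z = some i then A z y else 0) = N i y := fun i => by
      rw [hN]; exact Finset.sum_congr rfl fun z _ => by rw [symA z y]
    rw [h1]
    cases hx : f x with
    | none =>
      rw [QD x _ hx]
      cases hy : f y with
      | none => rw [QD y _ hy, hsame x y (Or.inl ⟨hx, hy⟩)]
      | some j =>
        rw [QC y j _ hy, hN' x j hx, key x y j hx hy]; ring
    | some i =>
      rw [QC x i _ hx, h2]
      cases hy : f y with
      | none => rw [QD y _ hy, key y x i hy hx, symA x y, symA' x y]; ring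
      | some j =>
        rw [QC y j _ hy, hsame x y (Or.inr ⟨by simp [hx], by simp [hy]⟩)]
        have h3 : (∑ z, if f z = some j then A' x z else 0) = N j x := by
          rw [hN]
          refine Finset.sum_congr rfl fun z _ => ?_
          split_ifs with hz
          · exact hsame x z (Or.inr ⟨by simp [hx], by simp [hz]⟩)
          · rfl
        rw [h3]
        have := dbl x y i j hx hy
        have ki := kpos x i hx
        have kj := kpos y j hy
        congr 1
        field_simp
        linarith
  have hch : A'.charpoly = A.charpoly := by
    have h := Matrix.charpoly_units_conj (⟨Q, Q, QQ, QQ⟩ : (Matrix X X ℚ)ˣ) A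
    rw [← h]
    congr 1
    change A' = Q * A * Q⁻¹
    rw [Matrix.inv_eq_right_inv QQ, comm, Matrix.mul_assoc, QQ, Matrix.mul_one]
  have hmap : ∀ G : SimpleGraph X,
      (G.adjMatrix ℤ).charpoly.map (Int.castRingHom ℚ) = (G.adjMatrix ℚ).charpoly := by
    intro G
    rw [← Matrix.charpoly_map]
    congr 1
    ext x y
    simp [SimpleGraph.adjMatrix_apply]
  apply Polynomial.map_injective (Int.castRingHom ℚ) Int.cast_injective
  rw [hmap, hmap, ← hA, ← hA', hch]



open scoped Classical in
/-- Godsil–McKay switching theorem: Let `Γ` be a finite graph with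
vertex set `X`, and let `{C_1, …, C_t, D}` be a partition of `X` such that
`{C_1, …, C_t}` is an equitable partition of the subgraph of `Γ` induced on `X \ D`
(for all `i, j` there is `m` such that every vertex of `C_j` has exactly `m` neighbors
in `C_i`), and such that every `x ∈ D` has either `0`, `|C_i|/2` or `|C_i|` neighbors
in `C_i` for each `i`. Let `Γ̃` be obtained by interchanging adjacency and nonadjacency
between `x ∈ D` and the vertices of `C_i` whenever `x` has exactly `|C_i|/2` neighbors
in `C_i`, keeping all other adjacencies. Then `Γ̃` and `Γ` are cospectral: their
adjacency matrices have the same characteristic polynomial. -/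
theorem stmt_13 {X : Type*} [Fintype X] (Γ Γ' : SimpleGraph X)
    (t : ℕ) (C : Fin t → Set X) (D : Set X)
    (hdisjC : Pairwise fun i j => Disjoint (C i) (C j))
    (hdisjD : ∀ i, Disjoint (C i) D)
    (hcover : (⋃ i, C i) ∪ D = Set.univ)
    (hequit : ∀ i j, ∃ m : ℕ, ∀ x ∈ C j, (Γ.neighborSet x ∩ C i).ncard = m)
    (hhalf : ∀ x ∈ D, ∀ i,
      (Γ.neighborSet x ∩ C i).ncard = 0 ∨
      2 * (Γ.neighborSet x ∩ C i).ncard = (C i).ncard ∨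
      (Γ.neighborSet x ∩ C i).ncard = (C i).ncard)
    (hsameCC : ∀ x y, x ∉ D → y ∉ D → (Γ'.Adj x y ↔ Γ.Adj x y))
    (hsameDD : ∀ x ∈ D, ∀ y ∈ D, (Γ'.Adj x y ↔ Γ.Adj x y))
    (hswitch : ∀ x ∈ D, ∀ i, ∀ y ∈ C i,
      (2 * (Γ.neighborSet x ∩ C i).ncard = (C i).ncard →
        (Γ'.Adj x y ↔ ¬ Γ.Adj x y)) ∧
      (2 * (Γ.neighborSet x ∩ C i).ncard ≠ (C i).ncard →
        (Γ'.Adj x y ↔ Γ.Adj x y))) :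
    (Γ'.adjMatrix ℤ).charpoly = (Γ.adjMatrix ℤ).charpoly := by
  have hf : ∀ x, ∃ o : Option (Fin t), (∀ i, x ∈ C i ↔ o = some i) ∧ (x ∈ D ↔ o = none) := by
    intro x
    by_cases hx : x ∈ D
    · refine ⟨none, fun i => ?_, by simp [hx]⟩
      have := Set.disjoint_right.mp (hdisjD i) hx
      simp [this]
    · have h : x ∈ (⋃ i, C i) ∪ D := by rw [hcover]; trivial
      rcases h with h | h
      · obtain ⟨i, hi⟩ := Set.mem_iUnion.mp h
        refine ⟨some i, fun j => ?_, by simp [hx]⟩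
        constructor
        · intro hj
          by_contra hne
          have hij : i ≠ j := fun e => hne (by rw [e])
          exact Set.disjoint_left.mp (hdisjC hij) hi hj
        · intro e
          cases e
          exact hi
      · exact absurd h hx
  choose f hfC hfD using hf
  have hcard : ∀ i, ((C i).ncard : ℚ) = ∑ z, if f z = some i then (1 : ℚ) else 0 := by
    intro i
    rw [Set.ncard_eq_toFinset_card', Finset.sum_boole]
    congr 2
    ext z
    simp [hfC]
  have hnb : ∀ x i, ((Γ.neighborSet x ∩ C i).ncard : ℚ)
      = ∑ z, if f z = some i then Γ.adjMatrix ℚ x z else 0 := by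
    intro x i
    rw [Set.ncard_eq_toFinset_card']
    simp only [SimpleGraph.adjMatrix_apply, ← ite_and]
    rw [Finset.sum_boole]
    congr 2
    ext z
    simp [hfC, and_comm]
  have hequit' : ∀ i x y, f x = f y → 
      (∑ z, if f z = some i then Γ.adjMatrix ℚ x z else 0) =
      (∑ z, if f z = some i then Γ.adjMatrix ℚ y z else 0) ∨ f x = none := by
    intro i x y hxy
    cases hx : f x with
    | none => right; rfl
    | some j =>
      left
      obtain ⟨m, hm⟩ := hequit i j
      rw [← hnb, ← hnb, hm x ((hfC x j).2 hx), hm y ((hfC y j).2 (hxy ▸ hx))]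
  exact godsil_mckay_aux Γ Γ' f (fun i x y j hx hy => by
      rcases hequit' i x y (hx.trans hy.symm) with h | h
      · exact h
      · rw [hx] at h; cases h)
    (fun x i hx => by
      rw [← hnb, ← hcard]
      have := hhalf x ((hfD x).2 hx) i
      exact_mod_cast this)
    (fun x y h => by
      rw [SimpleGraph.adjMatrix_apply, SimpleGraph.adjMatrix_apply]
      rcases h with ⟨h1, h2⟩ | ⟨h1, h2⟩
      · simp [hsameDD x ((hfD x).2 h1) y ((hfD y).2 h2)]
      · have := hsameCC x y (by rwa [hfD]) (by rwa [hfD])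
        simp [this])
    (fun x y i hx hy => by
      rw [← hnb, ← hcard]
      have := hswitch x ((hfD x).2 hx) i y ((hfC y i).2 hy)
      constructor
      · intro h
        have h' := this.1 (by exact_mod_cast h)
        simp only [SimpleGraph.adjMatrix_apply, h']
        by_cases hh : Γ.Adj x y <;> simp [hh]
      · intro h
        have h' := this.2 (by exact_mod_cast h)
        simp [SimpleGraph.adjMatrix_apply, h'])
end

section
/- If σ and τ are two polarities of H, then the switched graphs Γ̃_σ and Γ̃_τ obtained from the Grassmann graph J_q(2e+1,e+1) using σ and τ respectively are isomorphic. -/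
theorem aux_finrank_s14 {F M : Type*} [Field F] [AddCommGroup M] [Module F M]
    [FiniteDimensional F M] (f : Submodule F M ≃o Submodule F M) (U : Submodule F M) :
    Module.finrank F ↥(f U) = Module.finrank F ↥U := by
  have h : Module.length F ↥(f U) = Module.length F ↥U := by
    rw [Module.length_submodule, Module.length_submodule, Order.height_orderIso]
  rw [Module.length_eq_finrank, Module.length_eq_finrank] at h
  exact_mod_cast h

open Classical in
/-- Act by `f` on subspaces of `H`, trivially on the others. -/
noncomputable def auxMap {F V : Type*} [Field F] [AddCommGroup V] [Module F V]
    (H : Submodule F V) (f : Submodule F ↥H → Submodule F ↥H) (W : Submodule F V) :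
    Submodule F V :=
  if W ≤ H then Submodule.map H.subtype (f (Submodule.comap H.subtype W)) else W

theorem comap_map_H {F V : Type*} [Field F] [AddCommGroup V] [Module F V]
    (H : Submodule F V) (X : Submodule F ↥H) :
    Submodule.comap H.subtype (Submodule.map H.subtype X) = X :=
  Submodule.comap_map_eq_of_injective H.injective_subtype X

theorem auxMap_map {F V : Type*} [Field F] [AddCommGroup V] [Module F V]
    (H : Submodule F V) (f : Submodule F ↥H → Submodule F ↥H) (X : Submodule F ↥H) :
    auxMap H f (Submodule.map H.subtype X) = Submodule.map H.subtype (f X) := by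
  rw [auxMap, if_pos (Submodule.map_subtype_le H X), comap_map_H]

theorem auxMap_not {F V : Type*} [Field F] [AddCommGroup V] [Module F V]
    (H : Submodule F V) (f : Submodule F ↥H → Submodule F ↥H) (W : Submodule F V)
    (hW : ¬ W ≤ H) : auxMap H f W = W := by
  rw [auxMap, if_neg hW]

theorem exists_map {F V : Type*} [Field F] [AddCommGroup V] [Module F V]
    (H : Submodule F V) (W : Submodule F V) (hW : W ≤ H) :
    ∃ X : Submodule F ↥H, W = Submodule.map H.subtype X :=
  ⟨Submodule.comap H.subtype W, by rw [Submodule.map_comap_subtype, inf_eq_right.2 hW]⟩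

theorem finrank_map_H {F V : Type*} [Field F] [AddCommGroup V] [Module F V]
    (H : Submodule F V) (X : Submodule F ↥H) :
    Module.finrank F ↥(Submodule.map H.subtype X) = Module.finrank F ↥X :=
  Submodule.finrank_map_subtype_eq H X

theorem auxMap_inv {F V : Type*} [Field F] [AddCommGroup V] [Module F V]
    (H : Submodule F V) (f g : Submodule F ↥H → Submodule F ↥H) (h : ∀ X, g (f X) = X)
    (W : Submodule F V) : auxMap H g (auxMap H f W) = W := by
  by_cases hW : W ≤ H
  · obtain ⟨X, rfl⟩ := exists_map H W hW
    rw [auxMap_map, auxMap_map, h]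
  · rw [auxMap_not H f W hW, auxMap_not H g W hW]

theorem auxMap_finrank {F V : Type*} [Field F] [AddCommGroup V] [Module F V]
    [FiniteDimensional F V]
    (H : Submodule F V) (f : Submodule F ↥H ≃o Submodule F ↥H)
    (W : Submodule F V) : Module.finrank F ↥(auxMap H f W) = Module.finrank F ↥W := by
  by_cases hW : W ≤ H
  · obtain ⟨X, rfl⟩ := exists_map H W hW
    rw [auxMap_map, finrank_map_H, finrank_map_H, aux_finrank_s14]
  · rw [auxMap_not H f W hW]

/-- If `σ` and `τ` are two polarities of `H`, then the switched graphs
`Γ̃_σ` and `Γ̃_τ` obtained from the Grassmann graph `J_q(2e+1,e+1)` using `σ` and `τ`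
respectively are isomorphic. -/
theorem stmt_14 {F : Type*} [Field F] [Fintype F]
    {V : Type*} [AddCommGroup V] [Module F V] [FiniteDimensional F V]
    (e : ℕ) (he : 1 ≤ e) (hV : Module.finrank F V = 2 * e + 1)
    (H : Submodule F V) (hH : Module.finrank F ↥H = 2 * e)
    (σ τ : Submodule F ↥H → Submodule F ↥H)
    (hσinv : ∀ U, σ (σ U) = U)
    (hσanti : ∀ U U' : Submodule F ↥H, U ≤ U' → σ U' ≤ σ U)
    (hτinv : ∀ U, τ (τ U) = U)
    (hτanti : ∀ U U' : Submodule F ↥H, U ≤ U' → τ U' ≤ τ U) :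
    Nonempty (switchedGraph e H σ ≃g switchedGraph e H τ) := by
  have hσle : ∀ U U', σ U ≤ σ U' ↔ U' ≤ U := fun U U' =>
    ⟨fun h => by simpa [hσinv] using hσanti _ _ h, hσanti _ _⟩
  have hτle : ∀ U U', τ U ≤ τ U' ↔ U' ≤ U := fun U U' =>
    ⟨fun h => by simpa [hτinv] using hτanti _ _ h, hτanti _ _⟩
  let f : Submodule F ↥H ≃o Submodule F ↥H :=
    { toFun := fun U => τ (σ U)
      invFun := fun U => σ (τ U)
      left_inv := fun U => by simp [hσinv, hτinv]
      right_inv := fun U => by simp [hσinv, hτinv]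
      map_rel_iff' := by
        intro U U'
        simp [hσle, hτle] }
  have hf : ∀ U, f U = τ (σ U) := fun _ => rfl
  let E : {W : Submodule F V // Module.finrank F ↥W = e + 1} ≃
      {W : Submodule F V // Module.finrank F ↥W = e + 1} :=
    { toFun := fun W => ⟨auxMap H f W.1, by rw [auxMap_finrank, W.2]⟩
      invFun := fun W => ⟨auxMap H f.symm W.1, by rw [auxMap_finrank, W.2]⟩
      left_inv := fun W => Subtype.ext (auxMap_inv H f f.symm (fun X => by simp) W.1)
      right_inv := fun W => Subtype.ext (auxMap_inv H f.symm f (fun X => by simp) W.1) }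
  have hE : ∀ W, (E W).1 = auxMap H f W.1 := fun _ => rfl
  have key : ∀ W₁ W₂ : Submodule F V,
      ((¬ auxMap H f W₁ ≤ H ∧ ¬ auxMap H f W₂ ≤ H ∧
          Module.finrank F ↥(auxMap H f W₁ ⊓ auxMap H f W₂) = e) ∨
        (auxMap H f W₁ ≤ H ∧ auxMap H f W₂ ≤ H ∧
          Module.finrank F ↥(auxMap H f W₁ ⊓ auxMap H f W₂) = e) ∨
        (∃ U : Submodule F ↥H, Module.finrank F ↥U = e ∧
          ¬ auxMap H f W₁ ≤ H ∧ Submodule.comap H.subtype (auxMap H f W₁) = U ∧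
          auxMap H f W₂ ≤ H ∧ Submodule.map H.subtype (τ U) ≤ auxMap H f W₂)) ↔
      ((¬ W₁ ≤ H ∧ ¬ W₂ ≤ H ∧ Module.finrank F ↥(W₁ ⊓ W₂) = e) ∨
        (W₁ ≤ H ∧ W₂ ≤ H ∧ Module.finrank F ↥(W₁ ⊓ W₂) = e) ∨
        (∃ U : Submodule F ↥H, Module.finrank F ↥U = e ∧
          ¬ W₁ ≤ H ∧ Submodule.comap H.subtype W₁ = U ∧
          W₂ ≤ H ∧ Submodule.map H.subtype (σ U) ≤ W₂)) := by
    intro W₁ W₂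
    by_cases h1 : W₁ ≤ H <;> by_cases h2 : W₂ ≤ H
    · obtain ⟨X, rfl⟩ := exists_map H W₁ h1
      obtain ⟨Y, rfl⟩ := exists_map H W₂ h2
      have hr : Module.finrank F ↥(Submodule.map H.subtype (f X) ⊓ Submodule.map H.subtype (f Y)) =
          Module.finrank F ↥(Submodule.map H.subtype X ⊓ Submodule.map H.subtype Y) := by
        rw [← Submodule.map_inf _ H.injective_subtype, ← Submodule.map_inf _ H.injective_subtype,
          finrank_map_H, finrank_map_H, ← map_inf, aux_finrank_s14]
      rw [auxMap_map, auxMap_map, hr]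
      simp only [Submodule.map_subtype_le, not_true_eq_false, false_and, and_false,
        exists_false, true_and]
    · obtain ⟨X, rfl⟩ := exists_map H W₁ h1
      simp [auxMap_map, auxMap_not H f W₂ h2, h2, Submodule.map_subtype_le]
    · obtain ⟨Y, rfl⟩ := exists_map H W₂ h2
      simp only [auxMap_map, auxMap_not H f W₁ h1, h1, Submodule.map_subtype_le,
        not_true_eq_false, not_false_eq_true, false_and, and_false, true_and, false_or,
        Submodule.map_le_map_iff_of_injective H.injective_subtype, hf, hτle]
      have : ∀ U, σ Y ≤ U ↔ σ U ≤ Y := fun U => by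
        rw [← hσle U (σ Y), hσinv]
      simp only [this]
    · rw [auxMap_not H f W₁ h1, auxMap_not H f W₂ h2]
      simp only [h2, false_and, and_false, exists_false]
  refine ⟨⟨E, ?_⟩⟩
  intro W₁ W₂
  simp only [switchedGraph, SimpleGraph.fromRel_adj, ne_eq, E.injective.eq_iff]
  exact and_congr Iff.rfl (or_congr (key W₁.1 W₂.1) (key W₂.1 W₁.1))
end
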